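/- arXiv:1903.12304 — 3 statements merged into one kernel-verified Lean document; each statement's English description precedes it below -/
import Mathlib

section
/- Let d, s, d_A, d_B be positive integers with d·s = d_A·d_B, let M be a unitary map from ℂ^d⊗ℂ^s to ℂ^{d_A}⊗ℂ^{d_B}, and let ω be a density matrix on ℂ^s such that (M, ω) is a universal quantum masker for d-dimensional states. Then the von Neumann entropy of the safe state satisfies S(ω) ≥ log₂ d. -/
open Matrix Kronecker
open scoped ComplexOrder

noncomputable section

/-- A density matrix: positive semidefinite with trace 1. -/
def IsDensity {n : Type*} [Fintype n] (ρ : Matrix n n ℂ) : Prop :=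
  ρ.PosSemidef ∧ ρ.trace = 1

/-- The outer product `|v⟩⟨v|`. -/
def outer {n : Type*} (v : n → ℂ) : Matrix n n ℂ :=
  Matrix.of fun i j => v i * (starRingEnd ℂ) (v j)

/-- Partial trace over the second tensor factor. -/
def ptrace2 {m n : Type*} [Fintype n] (M : Matrix (m × n) (m × n) ℂ) :
    Matrix m m ℂ := Matrix.of fun i i' => ∑ j, M (i, j) (i', j)

/-- Partial trace over the first tensor factor. -/
def ptrace1 {m n : Type*} [Fintype m] (M : Matrix (m × n) (m × n) ℂ) :
    Matrix n n ℂ := Matrix.of fun j j' => ∑ i, M (i, j) (i, j')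

/-- `(M, ω)` is a universal quantum masker for `d`-dimensional states:
`M` is a unitary from `ℂ^d ⊗ ℂ^s` to `ℂ^{dA} ⊗ ℂ^{dB}`, `ω` is a density matrix on `ℂ^s`,
and both marginals of `Φ(ρ) = M (ρ ⊗ ω) M†` are independent of the input density matrix `ρ`. -/
def IsMasker (d s dA dB : ℕ) (M : Matrix (Fin dA × Fin dB) (Fin d × Fin s) ℂ)
    (ω : Matrix (Fin s) (Fin s) ℂ) : Prop :=
  Mᴴ * M = 1 ∧ M * Mᴴ = 1 ∧ IsDensity ω ∧
  ∃ (σA : Matrix (Fin dA) (Fin dA) ℂ) (σB : Matrix (Fin dB) (Fin dB) ℂ),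
    IsDensity σA ∧ IsDensity σB ∧
    ∀ ρ : Matrix (Fin d) (Fin d) ℂ, IsDensity ρ →
      ptrace2 (M * (ρ ⊗ₖ ω) * Mᴴ) = σA ∧ ptrace1 (M * (ρ ⊗ₖ ω) * Mᴴ) = σB

/-- Von Neumann entropy in bits: `-∑ λ log₂ λ` over the eigenvalues. -/
def vNEntropy {n : Type*} [Fintype n] [DecidableEq n] (ρ : Matrix n n ℂ) : ℝ :=
  if h : ρ.IsHermitian then -∑ i, h.eigenvalues i * Real.logb 2 (h.eigenvalues i)
  else 0

/-- The entropy (in nats) of the roots of the characteristic polynomial of a matrix. For Hermitian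
matrices this is the von Neumann entropy up to a factor `log 2`. -/
def spectralEntropy {n : Type*} [Fintype n] [DecidableEq n] (ρ : Matrix n n ℂ) : ℝ :=
  (ρ.charpoly.roots.map fun z => Real.negMulLog z.re).sum

section SpectralEntropy

variable {m n : Type*} [Fintype m] [DecidableEq m] [Fintype n] [DecidableEq n]

theorem spectralEntropy_eq_sum_eigenvalues {ρ : Matrix n n ℂ} (h : ρ.IsHermitian) :
    spectralEntropy ρ = ∑ i, Real.negMulLog (h.eigenvalues i) := by
  simp [spectralEntropy, h.roots_charpoly_eq_eigenvalues, Multiset.map_map]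

theorem vNEntropy_eq_spectralEntropy_div {ρ : Matrix n n ℂ} (h : ρ.IsHermitian) :
    vNEntropy ρ = spectralEntropy ρ / Real.log 2 := by
  rw [vNEntropy, dif_pos h, spectralEntropy_eq_sum_eigenvalues h, Finset.sum_div,
    ← Finset.sum_neg_distrib]
  refine Finset.sum_congr rfl fun i _ => ?_
  rw [Real.negMulLog, Real.logb]
  ring

theorem spectralEntropy_diagonal (f : n → ℂ) :
    spectralEntropy (diagonal f) = ∑ i, Real.negMulLog (f i).re := by
  rw [spectralEntropy, charpoly_diagonal, Polynomial.roots_prod]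
  · simp
  · simp [Finset.prod_ne_zero_iff, Polynomial.X_sub_C_ne_zero]

theorem spectralEntropy_transpose (ρ : Matrix n n ℂ) :
    spectralEntropy ρᵀ = spectralEntropy ρ := by
  rw [spectralEntropy, charpoly_transpose, spectralEntropy]

theorem spectralEntropy_mul_comm (A : Matrix m n ℂ) (B : Matrix n m ℂ) :
    spectralEntropy (A * B) = spectralEntropy (B * A) := by
  have h := congrArg (fun p => (p.roots.map fun z : ℂ => Real.negMulLog z.re).sum)
    (charpoly_mul_comm' A B)
  rw [Polynomial.roots_mul, Polynomial.roots_mul] at h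
  · simpa [spectralEntropy, Multiset.map_nsmul, Multiset.sum_nsmul] using h
  · exact mul_ne_zero (pow_ne_zero _ Polynomial.X_ne_zero) (charpoly_monic _).ne_zero
  · exact mul_ne_zero (pow_ne_zero _ Polynomial.X_ne_zero) (charpoly_monic _).ne_zero

theorem spectralEntropy_conj {U V : Matrix n n ℂ} (h : V * U = 1) (ρ : Matrix n n ℂ) :
    spectralEntropy (U * ρ * V) = spectralEntropy ρ := by
  rw [spectralEntropy_mul_comm, ← mul_assoc, h, one_mul]

theorem Matrix.IsHermitian.exists_unitary_diagonal {ρ : Matrix n n ℂ} (h : ρ.IsHermitian) :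
    ∃ U : Matrix n n ℂ, Uᴴ * U = 1 ∧ U * Uᴴ = 1 ∧
      ρ = U * diagonal (fun i => (h.eigenvalues i : ℂ)) * Uᴴ := by
  refine ⟨h.eigenvectorUnitary, ?_, ?_, ?_⟩
  · exact Unitary.coe_star_mul_self h.eigenvectorUnitary
  · exact Unitary.coe_mul_star_self h.eigenvectorUnitary
  · conv_lhs => rw [h.spectral_theorem, Unitary.conjStarAlgAut_apply]
    rfl

theorem Matrix.PosSemidef.exists_eq_mul_conjTranspose {ρ : Matrix n n ℂ} (h : ρ.PosSemidef) :
    ∃ Y : Matrix n n ℂ, ρ = Y * Yᴴ := by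
  obtain ⟨U, -, -, hd⟩ := h.isHermitian.exists_unitary_diagonal
  refine ⟨U * diagonal fun i => (Real.sqrt (h.isHermitian.eigenvalues i) : ℂ), ?_⟩
  conv_lhs => rw [hd]
  rw [conjTranspose_mul, diagonal_conjTranspose, mul_assoc, mul_assoc, ← mul_assoc (diagonal _),
    diagonal_mul_diagonal]
  congr 3
  ext i
  simp only [Pi.star_apply, RCLike.star_def, Complex.conj_ofReal]
  rw [← Complex.ofReal_mul, Real.mul_self_sqrt (h.eigenvalues_nonneg i)]

theorem spectralEntropy_one_kronecker {c : ℝ} {ρ : Matrix n n ℂ} (h : ρ.IsHermitian)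
    (hρ : ρ.trace = 1) (hc : c * Fintype.card m = 1) :
    spectralEntropy ((1 : Matrix m m ℂ) ⊗ₖ ((c : ℂ) • ρ)) =
      Real.log (Fintype.card m) + spectralEntropy ρ := by
  obtain ⟨U, hU, -, hd⟩ := h.exists_unitary_diagonal
  have hsum : ∑ i, h.eigenvalues i = 1 := by
    have := h.trace_eq_sum_eigenvalues
    rw [hρ] at this
    exact Complex.ofReal_injective (by simpa using this.symm)
  have hk : (1 : Matrix m m ℂ) ⊗ₖ ((c : ℂ) • ρ) = ((1 : Matrix m m ℂ) ⊗ₖ U) *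
      diagonal (fun x : m × n => (c : ℂ) * h.eigenvalues x.2) * ((1 : Matrix m m ℂ) ⊗ₖ Uᴴ) := by
    have : diagonal (fun x : m × n => (c : ℂ) * h.eigenvalues x.2) =
        (1 : Matrix m m ℂ) ⊗ₖ ((c : ℂ) • diagonal fun i => (h.eigenvalues i : ℂ)) := by
      rw [← diagonal_smul, ← diagonal_one, diagonal_kronecker_diagonal]
      simp
    rw [this, ← mul_kronecker_mul, ← mul_kronecker_mul]
    conv_lhs => rw [hd]
    simp
  have hlog : Real.log c = -Real.log (Fintype.card m) := by
    rw [eq_inv_of_mul_eq_one_left hc, Real.log_inv]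
  rw [hk, spectralEntropy_conj (by rw [← mul_kronecker_mul, hU, one_mul, one_kronecker_one]),
    spectralEntropy_diagonal, spectralEntropy_eq_sum_eigenvalues h, Fintype.sum_prod_type]
  have hmul : ∀ i, Real.negMulLog (((c : ℂ) * h.eigenvalues i).re) =
      c * (Real.log (Fintype.card m) * h.eigenvalues i + Real.negMulLog (h.eigenvalues i)) := by
    intro i
    rw [Complex.re_ofReal_mul, Complex.ofReal_re, Real.negMulLog_mul, Real.negMulLog, hlog]
    ring
  simp only [hmul, ← Finset.mul_sum, Finset.sum_add_distrib, hsum, Finset.sum_const,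
    Finset.card_univ, nsmul_eq_mul]
  linear_combination (Real.log (Fintype.card m) + ∑ i, Real.negMulLog (h.eigenvalues i)) * hc

/-- The spectral entropy is at most the Shannon entropy of the diagonal. -/
theorem spectralEntropy_le_sum_diag {ρ : Matrix n n ℂ} (h : ρ.PosSemidef) :
    spectralEntropy ρ ≤ ∑ j, Real.negMulLog (ρ j j).re := by
  obtain ⟨U, hU, hU', hd⟩ := h.isHermitian.exists_unitary_diagonal
  set l := h.isHermitian.eigenvalues
  have hrow : ∀ j, ∑ i, Complex.normSq (U j i) = 1 := by
    intro j
    have := congrFun (congrFun hU' j) j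
    simp only [mul_apply, conjTranspose_apply, RCLike.star_def, Complex.mul_conj, one_apply_eq]
      at this
    exact_mod_cast this
  have hcol : ∀ i, ∑ j, Complex.normSq (U j i) = 1 := by
    intro i
    have := congrFun (congrFun hU i) i
    simp only [mul_apply, conjTranspose_apply, RCLike.star_def, mul_comm, Complex.mul_conj,
      one_apply_eq] at this
    exact_mod_cast this
  have hdiag : ∀ j, (ρ j j).re = ∑ i, Complex.normSq (U j i) * l i := by
    intro j
    have : ρ j j = ((∑ i, Complex.normSq (U j i) * l i : ℝ) : ℂ) := by
      conv_lhs => rw [hd]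
      rw [mul_apply]
      simp only [mul_diagonal, conjTranspose_apply, RCLike.star_def]
      push_cast
      refine Finset.sum_congr rfl fun i _ => ?_
      rw [← Complex.mul_conj]
      ring
    rw [this, Complex.ofReal_re]
  rw [spectralEntropy_eq_sum_eigenvalues h.isHermitian]
  calc ∑ i, Real.negMulLog (l i)
      = ∑ i, (∑ j, Complex.normSq (U j i)) * Real.negMulLog (l i) := by simp [hcol]
    _ = ∑ j, ∑ i, Complex.normSq (U j i) • Real.negMulLog (l i) := by
      simp only [Finset.sum_mul, smul_eq_mul]
      exact Finset.sum_comm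
    _ ≤ ∑ j, Real.negMulLog (ρ j j).re := by
      refine Finset.sum_le_sum fun j _ => ?_
      rw [hdiag]
      exact Real.concaveOn_negMulLog.le_map_sum (fun i _ => Complex.normSq_nonneg _) (hrow j)
        fun i _ => h.eigenvalues_nonneg i

end SpectralEntropy

/-- Subadditivity of the Shannon entropy. -/
theorem sum_negMulLog_le_add_marginals {m n : Type*} [Fintype m] [Fintype n] {p : m → n → ℝ}
    (hp : ∀ a b, 0 ≤ p a b) (hsum : ∑ a, ∑ b, p a b = 1) :
    ∑ a, ∑ b, Real.negMulLog (p a b) ≤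
      ∑ a, Real.negMulLog (∑ b, p a b) + ∑ b, Real.negMulLog (∑ a, p a b) := by
  set q : m → ℝ := fun a => ∑ b, p a b
  set r : n → ℝ := fun b => ∑ a, p a b with hr
  have hqp : ∀ a b, p a b ≤ q a := fun a b =>
    Finset.single_le_sum (f := fun b => p a b) (fun b _ => hp a b) (Finset.mem_univ b)
  have hrp : ∀ a b, p a b ≤ r b := fun a b =>
    Finset.single_le_sum (f := fun a => p a b) (fun a _ => hp a b) (Finset.mem_univ a)
  have key : ∀ a b, Real.negMulLog (p a b) ≤
      (q a * r b - p a b) - p a b * Real.log (q a) - p a b * Real.log (r b) := by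
    intro a b
    rcases (hp a b).eq_or_lt with h0 | h0
    · simpa [← h0] using mul_nonneg ((hp a b).trans (hqp a b)) ((hp a b).trans (hrp a b))
    · have hq0 : 0 < q a := h0.trans_le (hqp a b)
      have hr0 : 0 < r b := h0.trans_le (hrp a b)
      have hlog := Real.log_le_sub_one_of_pos (div_pos (mul_pos hq0 hr0) h0)
      rw [Real.log_div (mul_pos hq0 hr0).ne' h0.ne', Real.log_mul hq0.ne' hr0.ne'] at hlog
      have hmul := mul_le_mul_of_nonneg_left hlog h0.le
      have hcancel : p a b * (q a * r b / p a b - 1) = q a * r b - p a b := by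
        field_simp
      rw [hcancel] at hmul
      rw [Real.negMulLog]
      linarith
  have hr1 : ∑ b, r b = 1 := by rw [← hsum]; exact Finset.sum_comm
  have hlast : ∑ a, ∑ b, p a b * Real.log (r b) = ∑ b, r b * Real.log (r b) := by
    rw [Finset.sum_comm]
    simp only [← Finset.sum_mul, hr]
  calc ∑ a, ∑ b, Real.negMulLog (p a b)
      ≤ ∑ a, ∑ b, ((q a * r b - p a b) - p a b * Real.log (q a) - p a b * Real.log (r b)) :=
        Finset.sum_le_sum fun a _ => Finset.sum_le_sum fun b _ => key a b
    _ = ∑ a, Real.negMulLog (q a) + ∑ b, Real.negMulLog (r b) := by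
      simp only [Finset.sum_sub_distrib, hlast, ← Finset.mul_sum, ← Finset.sum_mul, hr1, hsum,
        Real.negMulLog, neg_mul, Finset.sum_neg_distrib]
      have hq1 : ∑ a, q a = 1 := hsum
      have hfold : ∀ a, ∑ b, p a b = q a := fun _ => rfl
      simp only [mul_one, hfold, hq1]
      ring

theorem ptrace1_eq_ptrace2_swap {m n : Type*} [Fintype m] (ρ : Matrix (m × n) (m × n) ℂ) :
    ptrace1 ρ = ptrace2 (ρ.submatrix Prod.swap Prod.swap) := rfl

theorem isHermitian_ptrace2 {m n : Type*} [Fintype n] {ρ : Matrix (m × n) (m × n) ℂ}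
    (h : ρ.IsHermitian) : (ptrace2 ρ).IsHermitian := by
  ext i j
  simp only [ptrace2, conjTranspose_apply, of_apply, star_sum, h.apply]

theorem isHermitian_ptrace1 {m n : Type*} [Fintype m] {ρ : Matrix (m × n) (m × n) ℂ}
    (h : ρ.IsHermitian) : (ptrace1 ρ).IsHermitian :=
  isHermitian_ptrace2 (h.submatrix Prod.swap)

section PartialTrace

variable {m n : Type*} [Fintype m] [Fintype n]

theorem trace_ptrace1 (ρ : Matrix (m × n) (m × n) ℂ) : (ptrace1 ρ).trace = ρ.trace := by
  simp only [ptrace1, trace, diag_apply, of_apply, Fintype.sum_prod_type]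
  exact Finset.sum_comm

theorem ptrace2_conj_kronecker [DecidableEq n] {U : Matrix m m ℂ} {V : Matrix n n ℂ}
    (hV : V * Vᴴ = 1) (ρ : Matrix (m × n) (m × n) ℂ) :
    ptrace2 ((U ⊗ₖ V)ᴴ * ρ * (U ⊗ₖ V)) = Uᴴ * ptrace2 ρ * U := by
  have hV' : ∀ b b', ∑ j, V b' j * star (V b j) = if b' = b then 1 else 0 := fun b b' => by
    simpa [mul_apply, one_apply] using congrFun (congrFun hV b') b
  ext i i'
  simp only [ptrace2, of_apply, mul_apply, conjTranspose_apply, kroneckerMap_apply, star_mul',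
    Fintype.sum_prod_type, Finset.sum_mul, Finset.mul_sum]
  calc ∑ j, ∑ a', ∑ b', ∑ a, ∑ b,
        star (U a i) * star (V b j) * ρ (a, b) (a', b') * (U a' i' * V b' j)
      = ∑ a', ∑ b', ∑ a, ∑ b, ∑ j,
        star (U a i) * star (V b j) * ρ (a, b) (a', b') * (U a' i' * V b' j) := by
        rw [Finset.sum_comm]
        refine Finset.sum_congr rfl fun a' _ => ?_
        rw [Finset.sum_comm]
        refine Finset.sum_congr rfl fun b' _ => ?_
        rw [Finset.sum_comm]
        refine Finset.sum_congr rfl fun a _ => ?_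
        rw [Finset.sum_comm]
    _ = ∑ a', ∑ b', ∑ a, ∑ b,
        star (U a i) * ρ (a, b) (a', b') * U a' i' * (if b' = b then 1 else 0) := by
        simp only [← hV', Finset.mul_sum]
        refine Finset.sum_congr rfl fun a' _ => Finset.sum_congr rfl fun b' _ =>
          Finset.sum_congr rfl fun a _ => Finset.sum_congr rfl fun b _ =>
          Finset.sum_congr rfl fun j _ => ?_
        ring
    _ = _ := by
        simp only [mul_ite, mul_one, mul_zero, Finset.sum_ite_eq, Finset.mem_univ, if_true]
        refine Finset.sum_congr rfl fun a' _ => ?_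
        rw [Finset.sum_comm]

theorem ptrace1_conj_kronecker [DecidableEq m] {U : Matrix m m ℂ} {V : Matrix n n ℂ}
    (hU : U * Uᴴ = 1) (ρ : Matrix (m × n) (m × n) ℂ) :
    ptrace1 ((U ⊗ₖ V)ᴴ * ρ * (U ⊗ₖ V)) = Vᴴ * ptrace1 ρ * V := by
  rw [ptrace1_eq_ptrace2_swap, ptrace1_eq_ptrace2_swap, ← ptrace2_conj_kronecker hU]
  congr 1
  have hk : V ⊗ₖ U = (U ⊗ₖ V).submatrix (Equiv.prodComm n m) (Equiv.prodComm n m) := by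
    ext ⟨a, b⟩ ⟨c, d⟩
    simp [mul_comm]
  rw [hk]
  change ((U ⊗ₖ V)ᴴ * ρ * (U ⊗ₖ V)).submatrix (Equiv.prodComm n m) (Equiv.prodComm n m) =
    ((U ⊗ₖ V).submatrix (Equiv.prodComm n m) (Equiv.prodComm n m))ᴴ *
      ρ.submatrix (Equiv.prodComm n m) (Equiv.prodComm n m) * _
  rw [conjTranspose_submatrix, submatrix_mul_equiv, submatrix_mul_equiv]

variable [DecidableEq m] [DecidableEq n]

theorem spectralEntropy_le_of_ptrace_diagonal {ρ : Matrix (m × n) (m × n) ℂ} (h : IsDensity ρ)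
    {f : m → ℂ} {g : n → ℂ} (hf : ptrace2 ρ = diagonal f) (hg : ptrace1 ρ = diagonal g) :
    spectralEntropy ρ ≤ spectralEntropy (ptrace2 ρ) + spectralEntropy (ptrace1 ρ) := by
  have hf' : ∀ a, (f a).re = ∑ b, (ρ (a, b) (a, b)).re := fun a => by
    have := congrFun (congrFun hf a) a
    simp only [ptrace2, of_apply, diagonal_apply_eq] at this
    rw [← this, Complex.re_sum]
  have hg' : ∀ b, (g b).re = ∑ a, (ρ (a, b) (a, b)).re := fun b => by
    have := congrFun (congrFun hg b) b
    simp only [ptrace1, of_apply, diagonal_apply_eq] at this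
    rw [← this, Complex.re_sum]
  rw [hf, hg, spectralEntropy_diagonal, spectralEntropy_diagonal]
  simp only [hf', hg']
  refine (spectralEntropy_le_sum_diag h.1).trans ?_
  rw [Fintype.sum_prod_type]
  refine sum_negMulLog_le_add_marginals (p := fun a b => (ρ (a, b) (a, b)).re)
    (fun a b => (Complex.nonneg_iff.mp (h.1.diag_nonneg)).1) ?_
  have := congrArg Complex.re h.2
  simpa [trace, Fintype.sum_prod_type] using this

/-- Subadditivity of the von Neumann entropy. -/
theorem spectralEntropy_le_ptrace_add_ptrace {ρ : Matrix (m × n) (m × n) ℂ} (h : IsDensity ρ) :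
    spectralEntropy ρ ≤ spectralEntropy (ptrace2 ρ) + spectralEntropy (ptrace1 ρ) := by
  obtain ⟨U, hU, hU', hf⟩ := (isHermitian_ptrace2 h.1.isHermitian).exists_unitary_diagonal
  obtain ⟨V, hV, hV', hg⟩ := (isHermitian_ptrace1 h.1.isHermitian).exists_unitary_diagonal
  have hUV : (U ⊗ₖ V) * (U ⊗ₖ V)ᴴ = 1 := by
    rw [conjTranspose_kronecker, ← mul_kronecker_mul, hU', hV', one_kronecker_one]
  have h2 := ptrace2_conj_kronecker (U := U) hV' ρ
  have h1 := ptrace1_conj_kronecker (V := V) hU' ρ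
  have hdens : IsDensity ((U ⊗ₖ V)ᴴ * ρ * (U ⊗ₖ V)) := by
    refine ⟨h.1.conjTranspose_mul_mul_same _, ?_⟩
    rw [trace_mul_comm, ← mul_assoc, hUV, one_mul, h.2]
  have key := spectralEntropy_le_of_ptrace_diagonal hdens
    (h2.trans (by
      rw [hf, mul_assoc, mul_assoc, hU, mul_one, ← mul_assoc, hU, one_mul]))
    (h1.trans (by
      rw [hg, mul_assoc, mul_assoc, hV, mul_one, ← mul_assoc, hV, one_mul]))
  rwa [h2, h1, spectralEntropy_conj hUV, spectralEntropy_conj hU', spectralEntropy_conj hV']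
    at key

end PartialTrace

theorem isDensity_single {n : Type*} [Fintype n] [DecidableEq n] (i : n) :
    IsDensity (Matrix.single i i (1 : ℂ)) := by
  refine ⟨?_, by simp⟩
  rw [← diagonal_single]
  refine PosSemidef.diagonal fun j => ?_
  by_cases hj : j = i
  · subst hj; simp
  · simp [hj]

/-- A linear map constant on density matrices is the trace times that constant. -/
theorem LinearMap.eq_trace_smul_of_const_on_density {n E : Type*} [Fintype n] [DecidableEq n]
    [AddCommGroup E] [Module ℂ E] (L : Matrix n n ℂ →ₗ[ℂ] E) {σ : E}
    (hL : ∀ ρ, IsDensity ρ → L ρ = σ) (X : Matrix n n ℂ) : L X = X.trace • σ := by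
  have hdiag : ∀ i, L (Matrix.single i i 1) = σ := fun i => hL _ (isDensity_single i)
  have hoff : ∀ i j, i ≠ j → L (Matrix.single i j 1) = 0 := by
    intro i j hij
    have hphase : ∀ z : ℂ, z * star z = 1 →
        z • L (Matrix.single j i 1) + star z • L (Matrix.single i j 1) = 0 := by
      intro z hz
      let v : n → ℂ := Pi.single i 1 + Pi.single j z
      have hv : vecMulVec v (star v) = Matrix.single i i 1 + Matrix.single j j 1 + z • Matrix.single j i 1 +
          star z • Matrix.single i j 1 := by
        ext a b
        simp only [v, vecMulVec_apply, Matrix.single_apply, Pi.single_apply, Pi.add_apply,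
          Pi.star_apply, Matrix.add_apply, Matrix.smul_apply, smul_eq_mul, star_add,
          eq_comm (a := i) (b := a), eq_comm (a := j) (b := a),
          eq_comm (a := i) (b := b), eq_comm (a := j) (b := b)]
        by_cases ha : a = i <;> by_cases ha' : a = j <;> by_cases hb : b = i <;>
          by_cases hb' : b = j <;>
          simp only [ha, ha', hb, hb', hij, hij.symm, if_true, if_false, and_true, and_false,
            star_one, star_zero, hz, mul_one, one_mul, mul_zero, zero_mul, add_zero, zero_add]
      have htr : (vecMulVec v (star v)).trace = 2 := by
        rw [hv]
        simp [trace_single_eq_of_ne, hij, hij.symm]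
        norm_num
      have hdens : IsDensity ((2⁻¹ : ℂ) • vecMulVec v (star v)) := by
        refine ⟨(posSemidef_vecMulVec_self_star v).smul (inv_nonneg.mpr zero_le_two), ?_⟩
        rw [trace_smul, htr]
        norm_num
      have h := hL _ hdens
      rw [map_smul, hv] at h
      simp only [map_add, map_smul, hdiag] at h
      have h2 := congrArg (fun x => (2 : ℂ) • x) h
      simp only [smul_smul] at h2
      norm_num at h2
      rw [two_smul, add_assoc] at h2
      exact left_eq_add.mp h2.symm
    have h1 := hphase 1 (by simp)
    have h2 := hphase Complex.I (by simp)
    simp only [star_one, one_smul, RCLike.star_def, Complex.conj_I] at h1 h2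
    rw [eq_neg_of_add_eq_zero_left h1, smul_neg, neg_smul, ← neg_add, neg_eq_zero, ← two_smul ℂ,
      smul_smul] at h2
    exact (smul_eq_zero.mp h2).resolve_left (by simp)
  conv_lhs => rw [matrix_eq_sum_single X]
  simp only [map_sum]
  have hterm : ∀ i j, L (Matrix.single i j (X i j)) = if i = j then X i i • σ else 0 := by
    intro i j
    have : Matrix.single i j (X i j) = X i j • Matrix.single i j (1 : ℂ) := by simp
    rw [this, map_smul]
    split_ifs with hij
    · subst hij; rw [hdiag]
    · rw [hoff i j hij, smul_zero]
  simp only [hterm, Finset.sum_ite_eq, Finset.mem_univ, if_true]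
  exact Finset.sum_smul.symm

/-- The input-output entropy inequality for one marginal of a masking map, given as an operator `N`
whose extra input `s` purifies the safe state. -/
theorem log_card_add_spectralEntropy_le {r a b s : Type*} [Fintype r] [DecidableEq r] [Nonempty r]
    [Fintype a] [DecidableEq a] [Fintype b] [DecidableEq b] [Fintype s] [DecidableEq s]
    {N : Matrix (a × b) (r × s) ℂ} {σA : Matrix a a ℂ} {σB : Matrix b b ℂ} {τ : Matrix s s ℂ}
    (hσA : IsDensity σA)
    (hA : ∀ i j : r, ptrace2 (m := a) (n := b)
      (N * (Matrix.single i j (1 : ℂ) ⊗ₖ (1 : Matrix s s ℂ)) * Nᴴ) =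
      (Matrix.single i j (1 : ℂ)).trace • σA)
    (hB : ptrace1 (N * Nᴴ) = (Fintype.card r : ℂ) • σB)
    (hN : Nᴴ * N = (1 : Matrix r r ℂ) ⊗ₖ τ) (hτ : τ.trace = 1) :
    Real.log (Fintype.card r) + spectralEntropy σA ≤ spectralEntropy σB + spectralEntropy τ := by
  have hr : (Fintype.card r : ℝ) ≠ 0 := by simp
  set c : ℝ := (Fintype.card r : ℝ)⁻¹ with hc
  have hc0 : 0 ≤ c := by positivity
  have hcr : c * Fintype.card r = 1 := inv_mul_cancel₀ hr
  have hcr' : (c : ℂ) * Fintype.card r = 1 := by exact_mod_cast hcr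
  let X : Matrix (r × a) (b × s) ℂ := of fun x y => N (x.2, y.1) (x.1, y.2)
  have hleft : ((c : ℂ) • X) * Xᴴ = (1 : Matrix r r ℂ) ⊗ₖ ((c : ℂ) • σA) := by
    ext ⟨i, p⟩ ⟨j, q⟩
    have h := congrFun (congrFun (hA i j) p) q
    have hk : ∀ t, (N * (Matrix.single i j (1 : ℂ) ⊗ₖ (1 : Matrix s s ℂ)) * Nᴴ) (p, t) (q, t) =
        ∑ k, N (p, t) (i, k) * star (N (q, t) (j, k)) := by
      intro t
      simp only [mul_apply, kroneckerMap_apply, Fintype.sum_prod_type, conjTranspose_apply,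
        Matrix.single_apply, one_apply]
      simp [ite_and, Finset.sum_ite_eq, mul_ite, ite_mul]
    simp only [ptrace2, of_apply, hk] at h
    rw [Matrix.smul_mul]
    simp only [Matrix.smul_apply, mul_apply, conjTranspose_apply, X, of_apply,
      Fintype.sum_prod_type, kroneckerMap_apply, h, smul_eq_mul]
    by_cases hij : i = j
    · subst hij; simp
    · simp [hij]
  have h2 : ptrace2 (Xᴴ * ((c : ℂ) • X)) = σBᵀ := by
    ext p q
    have h := congrFun (congrFun hB q) p
    simp only [ptrace1, of_apply, mul_apply, Fintype.sum_prod_type, conjTranspose_apply,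
      Matrix.smul_apply, smul_eq_mul] at h
    have : (c : ℂ) * ((Fintype.card r : ℂ) * σB q p) = σB q p := by
      rw [← mul_assoc, hcr', one_mul]
    rw [← h] at this
    rw [transpose_apply, ← this]
    simp only [ptrace2, of_apply, Matrix.smul_apply, mul_apply, Fintype.sum_prod_type,
      conjTranspose_apply, X, smul_eq_mul, mul_left_comm _ (c : ℂ), ← Finset.mul_sum]
    congr 1
    calc ∑ k, ∑ i, ∑ e, star (N (e, p) (i, k)) * N (e, q) (i, k)
        = ∑ k, ∑ e, ∑ i, star (N (e, p) (i, k)) * N (e, q) (i, k) :=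
          Finset.sum_congr rfl fun k _ => Finset.sum_comm
      _ = ∑ e, ∑ i, ∑ k, star (N (e, p) (i, k)) * N (e, q) (i, k) := by
          rw [Finset.sum_comm]
          exact Finset.sum_congr rfl fun e _ => Finset.sum_comm
      _ = _ := by simp only [mul_comm]
  have h1 : ptrace1 (Xᴴ * ((c : ℂ) • X)) = τ := by
    ext k l
    have hi : ∀ i, ∑ p, ∑ q, star (N (p, q) (i, k)) * N (p, q) (i, l) = τ k l := fun i => by
      simpa [mul_apply, Fintype.sum_prod_type] using congrFun (congrFun hN (i, k)) (i, l)
    simp only [ptrace1, of_apply, Matrix.smul_apply, mul_apply, Fintype.sum_prod_type,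
      conjTranspose_apply, X, smul_eq_mul, mul_left_comm _ (c : ℂ), ← Finset.mul_sum]
    have : ∑ q, ∑ i, ∑ p, star (N (p, q) (i, k)) * N (p, q) (i, l) =
        ∑ i, ∑ p, ∑ q, star (N (p, q) (i, k)) * N (p, q) (i, l) := by
      rw [Finset.sum_comm]
      exact Finset.sum_congr rfl fun i _ => Finset.sum_comm
    rw [this]
    simp only [hi, Finset.sum_const, Finset.card_univ, nsmul_eq_mul]
    rw [← mul_assoc, hcr', one_mul]
  have hdens : IsDensity (Xᴴ * ((c : ℂ) • X)) := by
    constructor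
    · rw [Matrix.mul_smul]
      exact (posSemidef_conjTranspose_mul_self X).smul (by exact_mod_cast hc0)
    · rw [← trace_ptrace1, h1, hτ]
  have key := spectralEntropy_le_ptrace_add_ptrace hdens
  rwa [spectralEntropy_mul_comm, hleft, h2, h1, spectralEntropy_transpose,
    spectralEntropy_one_kronecker hσA.1.isHermitian hσA.2 hcr] at key

theorem ptrace1_conj_submatrix_swap {a b r : Type*} [Fintype a] [Fintype b] [Fintype r]
    (N : Matrix (a × b) r ℂ) (X : Matrix r r ℂ) :
    ptrace1 (N.submatrix Prod.swap id * X * (N.submatrix Prod.swap id)ᴴ) =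
      ptrace2 (N * X * Nᴴ) := rfl

theorem ptrace2_conj_submatrix_swap {a b r : Type*} [Fintype a] [Fintype b] [Fintype r]
    (N : Matrix (a × b) r ℂ) (X : Matrix r r ℂ) :
    ptrace2 (N.submatrix Prod.swap id * X * (N.submatrix Prod.swap id)ᴴ) =
      ptrace1 (N * X * Nᴴ) := rfl

/-- The linear extension of `ρ ↦ Tr₂ (M (ρ ⊗ ω) M†)`. -/
def ptrace2Linear {r a b s : Type*} [Fintype r] [Fintype s] [Fintype b]
    (M : Matrix (a × b) (r × s) ℂ) (ω : Matrix s s ℂ) :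
    Matrix r r ℂ →ₗ[ℂ] Matrix a a ℂ where
  toFun ρ := ptrace2 (M * (ρ ⊗ₖ ω) * Mᴴ)
  map_add' x y := by
    ext
    simp [ptrace2, add_kronecker, Matrix.mul_add, Matrix.add_mul, Finset.sum_add_distrib]
  map_smul' c x := by
    ext
    simp [ptrace2, smul_kronecker, Finset.mul_sum]

theorem ptrace2_eq_trace_smul {r a b s : Type*} [Fintype r] [DecidableEq r] [Fintype s]
    [Fintype b] {M : Matrix (a × b) (r × s) ℂ} {ω : Matrix s s ℂ} {σ : Matrix a a ℂ}
    (h : ∀ ρ : Matrix r r ℂ, IsDensity ρ → ptrace2 (M * (ρ ⊗ₖ ω) * Mᴴ) = σ) (X : Matrix r r ℂ) :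
    ptrace2 (M * (X ⊗ₖ ω) * Mᴴ) = X.trace • σ :=
  (ptrace2Linear M ω).eq_trace_smul_of_const_on_density h X

/-- the von Neumann entropy of the safe state of a universal quantum
masker for `d`-dimensional states is at least `log₂ d`. -/
theorem safe_state_entropy_lower_bound
    (d s dA dB : ℕ) (hd : 0 < d) (hs : 0 < s) (hdA : 0 < dA) (hdB : 0 < dB)
    (hdim : d * s = dA * dB)
    (M : Matrix (Fin dA × Fin dB) (Fin d × Fin s) ℂ)
    (ω : Matrix (Fin s) (Fin s) ℂ)
    (hM : IsMasker d s dA dB M ω) :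
    Real.logb 2 d ≤ vNEntropy ω := by
  obtain ⟨hMM, -, hω, σA, σB, hσA, hσB, hmask⟩ := hM
  have : Nonempty (Fin d) := ⟨⟨0, hd⟩⟩
  obtain ⟨Y, hY⟩ := hω.1.exists_eq_mul_conjTranspose
  set N := M * ((1 : Matrix (Fin d) (Fin d) ℂ) ⊗ₖ Y) with hNdef
  have hconj : ∀ X : Matrix (Fin d) (Fin d) ℂ,
      N * (X ⊗ₖ (1 : Matrix (Fin s) (Fin s) ℂ)) * Nᴴ = M * (X ⊗ₖ ω) * Mᴴ := by
    intro X
    have hX : X ⊗ₖ ω = ((1 : Matrix (Fin d) (Fin d) ℂ) ⊗ₖ Y) *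
        (X ⊗ₖ (1 : Matrix (Fin s) (Fin s) ℂ)) * ((1 : Matrix (Fin d) (Fin d) ℂ) ⊗ₖ Y)ᴴ := by
      rw [conjTranspose_kronecker, ← mul_kronecker_mul, ← mul_kronecker_mul, hY]
      simp
    rw [hX, hNdef, conjTranspose_mul]
    simp only [Matrix.mul_assoc]
  have hNN : Nᴴ * N = 1 ⊗ₖ (Yᴴ * Y) := by
    rw [hNdef, conjTranspose_mul, Matrix.mul_assoc, ← Matrix.mul_assoc Mᴴ, hMM, Matrix.one_mul,
      conjTranspose_kronecker, ← mul_kronecker_mul]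
    simp
  have hτ : (Yᴴ * Y).trace = 1 := by rw [trace_mul_comm, ← hY, hω.2]
  have hone : N * Nᴴ = M * ((1 : Matrix (Fin d) (Fin d) ℂ) ⊗ₖ ω) * Mᴴ := by
    rw [← hconj, one_kronecker_one, Matrix.mul_one]
  have hA : ∀ X : Matrix (Fin d) (Fin d) ℂ, ptrace2 (M * (X ⊗ₖ ω) * Mᴴ) = X.trace • σA :=
    ptrace2_eq_trace_smul fun ρ hρ => (hmask ρ hρ).1
  have hB : ∀ X : Matrix (Fin d) (Fin d) ℂ, ptrace1 (M * (X ⊗ₖ ω) * Mᴴ) = X.trace • σB :=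
    ptrace2_eq_trace_smul (M := M.submatrix Prod.swap id) fun ρ hρ => (hmask ρ hρ).2
  have h1 := log_card_add_spectralEntropy_le (N := N) (σB := σB) hσA
    (fun i j => by rw [hconj, hA]) (by rw [hone, hB, trace_one]) hNN hτ
  have hNN' : (N.submatrix Prod.swap id)ᴴ * N.submatrix Prod.swap id = 1 ⊗ₖ (Yᴴ * Y) := by
    rw [← hNN]
    exact submatrix_mul_equiv Nᴴ N id (Equiv.prodComm _ _) id
  have h2 := log_card_add_spectralEntropy_le (N := N.submatrix Prod.swap id) (σB := σA) hσB
    (fun i j => by rw [ptrace2_conj_submatrix_swap, hconj, hB])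
    (by
      have h := ptrace1_conj_submatrix_swap N 1
      rw [Matrix.mul_one, Matrix.mul_one] at h
      rw [h, hone, hA, trace_one]) hNN' hτ
  rw [spectralEntropy_mul_comm, ← hY, Fintype.card_fin] at h1 h2
  rw [vNEntropy_eq_spectralEntropy_div hω.1.isHermitian, Real.logb]
  have hlog2 : 0 < Real.log 2 := Real.log_pos one_lt_two
  gcongr
  linarith

end
end

section
/- Let d ≥ 2 and let (M, ω) be a universal quantum masker for d-dimensional states, with M a unitary from ℂ^d⊗ℂ^s to ℂ^{d_A}⊗ℂ^{d_B} and safe state ω on ℂ^s. Suppose in addition that for every density matrix ρ on ℂ^d the masked state Φ(ρ) = M(ρ⊗ω)M† is separable, i.e. Φ(ρ) = ∑_k p_k α_k⊗β_k for some finitely many weights p_k ≥ 0 with ∑_k p_k = 1 and density matrices α_k on ℂ^{d_A} and β_k on ℂ^{d_B}. Then the von Neumann entropy of ω is strictly larger than log₂ d. -/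
open Matrix Kronecker
open scoped ComplexOrder

noncomputable section

section Frame

variable {P Q : Type*} [Fintype P] [Fintype Q] [DecidableEq Q]

/-- Parseval's identity for a weighted family of vectors whose frame operator is diagonal. -/
lemma frame_identity {u : P → Q → ℂ} {w : P → ℝ} {μ : Q → ℝ}
    (h : ∀ q q', ∑ p, (w p : ℂ) * (star (u p q) * u p q') = if q = q' then (μ q : ℂ) else 0)
    (p : P) :
    ∑ p', w p' * ‖∑ q, star (u p q) * u p' q / μ q‖ ^ 2 = ∑ q, ‖u p q‖ ^ 2 / μ q := by
  have key : ∀ p', ((w p' * ‖∑ q, star (u p q) * u p' q / μ q‖ ^ 2 : ℝ) : ℂ) =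
      ∑ q, ∑ q', (u p q * star (u p q') / (μ q * μ q')) *
        ((w p' : ℂ) * (star (u p' q) * u p' q')) := by
    intro p'
    push_cast
    rw [← Complex.conj_mul', map_sum, Finset.sum_mul_sum, Finset.mul_sum]
    refine Finset.sum_congr rfl fun q _ => ?_
    rw [Finset.mul_sum]
    refine Finset.sum_congr rfl fun q' _ => ?_
    simp
    ring
  have : ((∑ p', w p' * ‖∑ q, star (u p q) * u p' q / μ q‖ ^ 2 : ℝ) : ℂ) =
      ((∑ q, ‖u p q‖ ^ 2 / μ q : ℝ) : ℂ) := by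
    rw [Complex.ofReal_sum, Finset.sum_congr rfl fun p' _ => key p', Finset.sum_comm,
      Complex.ofReal_sum]
    refine Finset.sum_congr rfl fun q _ => ?_
    rw [Finset.sum_comm]
    simp_rw [← Finset.mul_sum, h]
    simp only [mul_ite, mul_zero, Finset.sum_ite_eq, Finset.mem_univ, if_true]
    push_cast
    rw [← Complex.mul_conj']
    by_cases hq : (μ q : ℂ) = 0
    · simp [hq]
    · simp; field_simp
  exact_mod_cast this

lemma frame_bound {u : P → Q → ℂ} {w : P → ℝ} {μ : Q → ℝ} (hw : ∀ p, 0 ≤ w p)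
    (hμ : ∀ q, 0 ≤ μ q)
    (h : ∀ q q', ∑ p, (w p : ℂ) * (star (u p q) * u p q') = if q = q' then (μ q : ℂ) else 0)
    (p : P) : w p * ∑ q, ‖u p q‖ ^ 2 / μ q ≤ 1 := by
  set T := ∑ q, ‖u p q‖ ^ 2 / μ q with hT
  have hT0 : 0 ≤ T := Finset.sum_nonneg fun q _ => div_nonneg (sq_nonneg _) (hμ q)
  have hpp : ‖∑ q, star (u p q) * u p q / μ q‖ = T := by
    have : ∑ q, star (u p q) * u p q / μ q = (T : ℂ) := by
      rw [hT, Complex.ofReal_sum]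
      refine Finset.sum_congr rfl fun q _ => ?_
      push_cast
      rw [← Complex.conj_mul']; rfl
    rw [this, Complex.norm_real, Real.norm_of_nonneg hT0]
  have h1 := frame_identity h p
  have h2 := Finset.single_le_sum (f := fun p' => w p' * ‖∑ q, star (u p q) * u p' q / μ q‖ ^ 2)
    (fun p' _ => mul_nonneg (hw p') (sq_nonneg _)) (Finset.mem_univ p)
  simp only [hpp] at h2
  rw [h1, ← hT] at h2
  rcases hT0.eq_or_lt with h0 | h0
  · rw [← h0]; simp
  · nlinarith

lemma frame_orthogonal {u : P → Q → ℂ} {w : P → ℝ} {μ : Q → ℝ} (hw : ∀ p, 0 ≤ w p)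
    (hμ : ∀ q, 0 ≤ μ q)
    (h : ∀ q q', ∑ p, (w p : ℂ) * (star (u p q) * u p q') = if q = q' then (μ q : ℂ) else 0)
    {p p' : P} (hp : w p * ∑ q, ‖u p q‖ ^ 2 / μ q = 1) (hne : p ≠ p') (hp' : w p' ≠ 0) :
    ∑ q, star (u p q) * u p' q / μ q = 0 := by
  classical
  set T := ∑ q, ‖u p q‖ ^ 2 / μ q with hT
  have hT0 : 0 ≤ T := Finset.sum_nonneg fun q _ => div_nonneg (sq_nonneg _) (hμ q)
  have hpp : ‖∑ q, star (u p q) * u p q / μ q‖ = T := by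
    have : ∑ q, star (u p q) * u p q / μ q = (T : ℂ) := by
      rw [hT, Complex.ofReal_sum]
      refine Finset.sum_congr rfl fun q _ => ?_
      push_cast
      rw [← Complex.conj_mul']; rfl
    rw [this, Complex.norm_real, Real.norm_of_nonneg hT0]
  have h1 := frame_identity h p
  have h2 := Finset.add_le_sum (f := fun p' => w p' * ‖∑ q, star (u p q) * u p' q / μ q‖ ^ 2)
    (fun p' _ => mul_nonneg (hw p') (sq_nonneg _)) (Finset.mem_univ p) (Finset.mem_univ p') hne
  simp only [hpp] at h2
  rw [h1, ← hT] at h2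
  have h3 : w p * T ^ 2 = T := by rw [pow_two, ← mul_assoc, hp, one_mul]
  have h4 : ‖∑ q, star (u p q) * u p' q / μ q‖ ^ 2 ≤ 0 := by
    have := lt_of_le_of_ne (hw p') (Ne.symm hp')
    by_contra! hc
    nlinarith [mul_pos this hc]
  exact norm_eq_zero.1 (pow_eq_zero_iff two_ne_zero |>.1 (le_antisymm h4 (sq_nonneg _)))

end Frame

/-- A masking isometry in bases diagonalising the safe state (spectrum `l`) and both marginals
(spectra `μ` and `ν`), written as a four-index tensor. -/
structure MaskTensor {ι κ α β : Type*} [Fintype ι] [Fintype κ] [Fintype α] [Fintype β]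
    [DecidableEq ι] [DecidableEq κ] [DecidableEq α] [DecidableEq β]
    (x : ι → κ → α → β → ℂ) (l : κ → ℝ) (μ : α → ℝ) (ν : β → ℝ) : Prop where
  l_nonneg : ∀ k, 0 ≤ l k
  μ_nonneg : ∀ m, 0 ≤ μ m
  ν_nonneg : ∀ n, 0 ≤ ν n
  μ_sum : ∑ m, μ m = 1
  ν_sum : ∑ n, ν n = 1
  isometry : ∀ p p' : ι × κ, ∑ q : α × β,
    star (x p.1 p.2 q.1 q.2) * x p'.1 p'.2 q.1 q.2 = if p = p' then 1 else 0
  row_norm : ∀ m n, ∑ p : ι × κ, ‖x p.1 p.2 m n‖ ^ 2 = 1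
  marginal_fst : ∀ q q' : ι × α, ∑ p : κ × β,
    (l p.1 : ℂ) * (star (x q.1 p.1 q.2 p.2) * x q'.1 p.1 q'.2 p.2) =
      if q = q' then (μ q.2 : ℂ) else 0
  marginal_snd : ∀ q q' : ι × β, ∑ p : κ × α,
    (l p.1 : ℂ) * (star (x q.1 p.1 p.2 q.2) * x q'.1 p.1 p.2 q'.2) =
      if q = q' then (ν q.2 : ℂ) else 0

namespace MaskTensor

variable {ι κ α β : Type*} [Fintype ι] [Fintype κ] [Fintype α] [Fintype β]
  [DecidableEq ι] [DecidableEq κ] [DecidableEq α] [DecidableEq β]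
  {x : ι → κ → α → β → ℂ} {l : κ → ℝ} {μ : α → ℝ} {ν : β → ℝ}

/-- Exchanging the two output systems. -/
lemma swap (h : MaskTensor x l μ ν) : MaskTensor (fun i k n m => x i k m n) l ν μ where
  l_nonneg := h.l_nonneg
  μ_nonneg := h.ν_nonneg
  ν_nonneg := h.μ_nonneg
  μ_sum := h.ν_sum
  ν_sum := h.μ_sum
  isometry p p' := by
    rw [← h.isometry p p']
    exact Fintype.sum_equiv (Equiv.prodComm β α) _ _ fun _ => rfl
  row_norm n m := h.row_norm m n
  marginal_fst := h.marginal_snd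
  marginal_snd := h.marginal_fst

lemma sum_norm_sq_fst (h : MaskTensor x l μ ν) (i : ι) (m : α) :
    ∑ p : κ × β, l p.1 * ‖x i p.1 m p.2‖ ^ 2 = μ m := by
  have := h.marginal_fst (i, m) (i, m)
  simp only [Complex.star_def, Complex.conj_mul', if_true] at this
  exact_mod_cast this

lemma eq_zero_of_fst (h : MaskTensor x l μ ν) {k : κ} {m : α} (hk : l k ≠ 0) (hm : μ m = 0)
    (i : ι) (n : β) : x i k m n = 0 := by
  have h1 := h.sum_norm_sq_fst i m
  rw [hm, Finset.sum_eq_zero_iff_of_nonneg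
    (fun p _ => mul_nonneg (h.l_nonneg _) (sq_nonneg _))] at h1
  simpa [hk] using h1 (k, n) (Finset.mem_univ _)

lemma eq_zero_of_snd (h : MaskTensor x l μ ν) {k : κ} {n : β} (hk : l k ≠ 0) (hn : ν n = 0)
    (i : ι) (m : α) : x i k m n = 0 :=
  h.swap.eq_zero_of_fst hk hn i m

lemma sum_norm_sq (h : MaskTensor x l μ ν) (k : κ) :
    ∑ i, ∑ m, ∑ n, ‖x i k m n‖ ^ 2 = Fintype.card ι := by
  have : ∀ i, ∑ m, ∑ n, ‖x i k m n‖ ^ 2 = (1 : ℝ) := by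
    intro i
    have := h.isometry (i, k) (i, k)
    simp only [Complex.star_def, Complex.conj_mul', if_true, Fintype.sum_prod_type] at this
    exact_mod_cast this
  simp [this]

/-- The sum of the two frame bounds minus the norm, split into its nonnegative contributions. -/
lemma balance (h : MaskTensor x l μ ν) {k : κ} (hk : l k ≠ 0) :
    (∑ n, ν n * (1 - l k * ∑ q : ι × α, ‖x q.1 k q.2 n‖ ^ 2 / μ q.2)) +
      (∑ m, μ m * (1 - l k * ∑ q : ι × β, ‖x q.1 k m q.2‖ ^ 2 / ν q.2)) +
      l k * ∑ i, ∑ m, ∑ n, ‖x i k m n‖ ^ 2 * ((μ m - ν n) ^ 2 / (μ m * ν n)) =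
      2 - 2 * (l k * Fintype.card ι) := by
  have e1 : ∑ n, ν n * (1 - l k * ∑ q : ι × α, ‖x q.1 k q.2 n‖ ^ 2 / μ q.2) =
      1 - l k * ∑ i, ∑ m, ∑ n, ‖x i k m n‖ ^ 2 * (ν n / μ m) := by
    simp_rw [mul_sub, mul_one, Finset.sum_sub_distrib, h.ν_sum, Fintype.sum_prod_type,
      Finset.mul_sum]
    rw [Finset.sum_comm]
    congr 1
    refine Finset.sum_congr rfl fun i _ => ?_
    rw [Finset.sum_comm]
    exact Finset.sum_congr rfl fun m _ => Finset.sum_congr rfl fun n _ => by ring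
  have e2 : ∑ m, μ m * (1 - l k * ∑ q : ι × β, ‖x q.1 k m q.2‖ ^ 2 / ν q.2) =
      1 - l k * ∑ i, ∑ m, ∑ n, ‖x i k m n‖ ^ 2 * (μ m / ν n) := by
    simp_rw [mul_sub, mul_one, Finset.sum_sub_distrib, h.μ_sum, Fintype.sum_prod_type,
      Finset.mul_sum]
    rw [Finset.sum_comm]
    congr 1
    exact Finset.sum_congr rfl fun i _ => Finset.sum_congr rfl fun m _ =>
      Finset.sum_congr rfl fun n _ => by ring
  have e3 : ∑ i, ∑ m, ∑ n, ‖x i k m n‖ ^ 2 * ((μ m - ν n) ^ 2 / (μ m * ν n)) =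
      (∑ i, ∑ m, ∑ n, ‖x i k m n‖ ^ 2 * (ν n / μ m)) +
      (∑ i, ∑ m, ∑ n, ‖x i k m n‖ ^ 2 * (μ m / ν n)) -
      2 * ∑ i, ∑ m, ∑ n, ‖x i k m n‖ ^ 2 := by
    simp_rw [Finset.mul_sum, ← Finset.sum_add_distrib, ← Finset.sum_sub_distrib]
    refine Finset.sum_congr rfl fun i _ => Finset.sum_congr rfl fun m _ =>
      Finset.sum_congr rfl fun n _ => ?_
    by_cases hm : μ m = 0
    · simp [h.eq_zero_of_fst hk hm]
    by_cases hn : ν n = 0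
    · simp [h.eq_zero_of_snd hk hn]
    field_simp
    ring
  rw [e1, e2, e3, h.sum_norm_sq]
  ring

lemma defect_nonneg (h : MaskTensor x l μ ν) (k : κ) (n : β) :
    0 ≤ ν n * (1 - l k * ∑ q : ι × α, ‖x q.1 k q.2 n‖ ^ 2 / μ q.2) :=
  mul_nonneg (h.ν_nonneg n) (sub_nonneg.2 (frame_bound (u := fun (p : κ × β) (q : ι × α) =>
    x q.1 p.1 q.2 p.2) (w := fun p => l p.1) (μ := fun q => μ q.2) (fun _ => h.l_nonneg _)
    (fun _ => h.μ_nonneg _) h.marginal_fst (k, n)))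

lemma mismatch_nonneg (h : MaskTensor x l μ ν) (i : ι) (k : κ) (m : α) (n : β) :
    0 ≤ ‖x i k m n‖ ^ 2 * ((μ m - ν n) ^ 2 / (μ m * ν n)) :=
  mul_nonneg (sq_nonneg _) (div_nonneg (sq_nonneg _) (mul_nonneg (h.μ_nonneg _) (h.ν_nonneg _)))

/-- No eigenvalue of the safe state exceeds `1 / d`. -/
lemma eigenvalue_le (h : MaskTensor x l μ ν) (k : κ) : l k * Fintype.card ι ≤ 1 := by
  by_cases hk : l k = 0
  · simp [hk]
  have h1 := Finset.sum_nonneg fun n (_ : n ∈ Finset.univ) => h.defect_nonneg k n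
  have h2 := Finset.sum_nonneg fun n (_ : n ∈ Finset.univ) => h.swap.defect_nonneg k n
  have h3 : 0 ≤ ∑ i, ∑ m, ∑ n, ‖x i k m n‖ ^ 2 * ((μ m - ν n) ^ 2 / (μ m * ν n)) :=
    Finset.sum_nonneg fun i _ => Finset.sum_nonneg fun m _ => Finset.sum_nonneg fun n _ =>
      h.mismatch_nonneg i k m n
  have h4 := mul_nonneg (h.l_nonneg k) h3
  linarith [h.balance hk]

omit [Fintype κ] [DecidableEq ι] [DecidableEq κ] in
lemma ne_zero_of_extremal {k : κ} (hk : l k * Fintype.card ι = 1) : l k ≠ 0 := by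
  rintro h0
  simp [h0] at hk

section Extremal

variable (h : MaskTensor x l μ ν) {k : κ} (hk : l k * Fintype.card ι = 1)
include h hk

lemma frame_bound_eq {n : β} (hn : ν n ≠ 0) :
    l k * ∑ q : ι × α, ‖x q.1 k q.2 n‖ ^ 2 / μ q.2 = 1 := by
  have h1 := Finset.sum_nonneg fun n (_ : n ∈ Finset.univ) => h.defect_nonneg k n
  have h2 := Finset.sum_nonneg fun n (_ : n ∈ Finset.univ) => h.swap.defect_nonneg k n
  have h3 : 0 ≤ ∑ i, ∑ m, ∑ n, ‖x i k m n‖ ^ 2 * ((μ m - ν n) ^ 2 / (μ m * ν n)) :=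
    Finset.sum_nonneg fun i _ => Finset.sum_nonneg fun m _ => Finset.sum_nonneg fun n _ =>
      h.mismatch_nonneg i k m n
  have h4 := mul_nonneg (h.l_nonneg k) h3
  have h5 := h.balance (ne_zero_of_extremal hk)
  have h6 := (Finset.sum_eq_zero_iff_of_nonneg fun n _ => h.defect_nonneg k n).1
    (le_antisymm (by linarith) h1) n (Finset.mem_univ _)
  have h7 := (mul_eq_zero.1 h6).resolve_left hn
  linarith

lemma spectra_match {i : ι} {m : α} {n : β} (hx : x i k m n ≠ 0) : μ m = ν n := by
  have hk0 := ne_zero_of_extremal hk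
  have h1 := Finset.sum_nonneg fun n (_ : n ∈ Finset.univ) => h.defect_nonneg k n
  have h2 := Finset.sum_nonneg fun n (_ : n ∈ Finset.univ) => h.swap.defect_nonneg k n
  have h3 : 0 ≤ ∑ i, ∑ m, ∑ n, ‖x i k m n‖ ^ 2 * ((μ m - ν n) ^ 2 / (μ m * ν n)) :=
    Finset.sum_nonneg fun i _ => Finset.sum_nonneg fun m _ => Finset.sum_nonneg fun n _ =>
      h.mismatch_nonneg i k m n
  have h4 := mul_nonneg (h.l_nonneg k) h3
  have h5 := h.balance hk0
  have h6 := (mul_eq_zero.1 (le_antisymm (by linarith) h4)).resolve_left hk0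
  have h7 := (Finset.sum_eq_zero_iff_of_nonneg fun i _ => Finset.sum_nonneg fun m _ =>
    Finset.sum_nonneg fun n _ => h.mismatch_nonneg i k m n).1 h6 i (Finset.mem_univ _)
  have h8 := (Finset.sum_eq_zero_iff_of_nonneg fun m _ =>
    Finset.sum_nonneg fun n _ => h.mismatch_nonneg i k m n).1 h7 m (Finset.mem_univ _)
  have h9 := (Finset.sum_eq_zero_iff_of_nonneg fun n _ => h.mismatch_nonneg i k m n).1
    h8 n (Finset.mem_univ _)
  have hm : μ m ≠ 0 := fun hm => hx (h.eq_zero_of_fst hk0 hm i n)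
  have hn : ν n ≠ 0 := fun hn => hx (h.eq_zero_of_snd hk0 hn i m)
  have : (μ m - ν n) ^ 2 = 0 := by simpa [hx, hm, hn] using h9
  exact sub_eq_zero.1 (pow_eq_zero_iff two_ne_zero |>.1 this)

end Extremal

/-- If the safe state is flat, the tensor is also an isometry from the safe and second output
systems, up to the marginal spectrum. -/
lemma isometry_snd (h : MaskTensor x l μ ν) (hl : ∀ k, l k ≠ 0 → l k * Fintype.card ι = 1)
    (p p' : κ × β) (hp : l p.1 ≠ 0) (hp' : l p'.1 ≠ 0) :
    ∑ q : ι × α, star (x q.1 p.1 q.2 p.2) * x q.1 p'.1 q.2 p'.2 =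
      if p = p' then ((Fintype.card ι * ν p.2 : ℝ) : ℂ) else 0 := by
  by_cases hn : ν p.2 = 0
  · simp [h.eq_zero_of_snd hp hn, hn]
  have hkey : ∀ q : ι × α, star (x q.1 p.1 q.2 p.2) * x q.1 p'.1 q.2 p'.2 =
      ν p.2 * (star (x q.1 p.1 q.2 p.2) * x q.1 p'.1 q.2 p'.2 / μ q.2) := by
    intro q
    by_cases hx : x q.1 p.1 q.2 p.2 = 0
    · simp [hx]
    rw [h.spectra_match (hl _ hp) hx]
    have : (ν p.2 : ℂ) ≠ 0 := by exact_mod_cast hn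
    field_simp
  have hT := h.frame_bound_eq (hl _ hp) hn
  rw [Finset.sum_congr rfl fun q _ => hkey q, ← Finset.mul_sum]
  split_ifs with hpp
  · subst hpp
    have h1 : ∑ q : ι × α, ‖x q.1 p.1 q.2 p.2‖ ^ 2 / μ q.2 = Fintype.card ι :=
      mul_left_cancel₀ hp (hT.trans (hl _ hp).symm)
    have h2 : ∑ q : ι × α, star (x q.1 p.1 q.2 p.2) * x q.1 p.1 q.2 p.2 / μ q.2 =
        (Fintype.card ι : ℂ) := by
      simp only [Complex.star_def, Complex.conj_mul']
      exact_mod_cast h1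
    rw [h2]; push_cast; ring
  · rw [frame_orthogonal (u := fun (p : κ × β) (q : ι × α) => x q.1 p.1 q.2 p.2)
      (w := fun p => l p.1) (μ := fun q => μ q.2) (fun _ => h.l_nonneg _)
      (fun _ => h.μ_nonneg _) h.marginal_fst hT hpp hp', mul_zero]

end MaskTensor

section Sums

variable {P Q : Type*} [Fintype P] [Fintype Q]

lemma sum_star_mul_of_isometry [DecidableEq P] {G : P → Q → ℂ} {e : P → ℂ} {S : P → Prop}
    (hG : ∀ p p', S p → S p' → ∑ q, star (G p q) * G p' q = if p = p' then e p else 0)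
    {y y' : P → ℂ} (hy : ∀ p, y p ≠ 0 → S p) (hy' : ∀ p, y' p ≠ 0 → S p) :
    ∑ q, star (∑ p, y p * G p q) * (∑ p, y' p * G p q) = ∑ p, star (y p) * y' p * e p := by
  have h1 : ∀ q, star (∑ p, y p * G p q) * (∑ p, y' p * G p q) =
      ∑ p, ∑ p', star (y p) * y' p' * (star (G p q) * G p' q) := by
    intro q
    rw [star_sum, Finset.sum_mul_sum]
    refine Finset.sum_congr rfl fun p _ => Finset.sum_congr rfl fun p' _ => ?_
    rw [star_mul']
    ring
  rw [Finset.sum_congr rfl fun q _ => h1 q, Finset.sum_comm]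
  refine Finset.sum_congr rfl fun p _ => ?_
  rw [Finset.sum_comm]
  simp_rw [← Finset.mul_sum]
  rw [Finset.sum_eq_single p]
  · by_cases hp : y p = 0
    · simp [hp]
    · rw [hG p p (hy p hp) (hy p hp), if_pos rfl]
  · intro p' _ hne
    by_cases hp : y p = 0
    · simp [hp]
    by_cases hp' : y' p' = 0
    · simp [hp']
    rw [hG p p' (hy p hp) (hy' p' hp'), if_neg hne.symm, mul_zero]
  · simp

lemma sum_star_prod_mul_prod (f f' : P → ℂ) (g g' : Q → ℂ) :
    ∑ p : P × Q, star (f p.1 * g p.2) * (f' p.1 * g' p.2) =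
      (star f ⬝ᵥ f') * (star g ⬝ᵥ g') := by
  simp only [dotProduct, Finset.sum_mul_sum, Fintype.sum_prod_type, Pi.star_apply, star_mul']
  exact Finset.sum_congr rfl fun _ _ => Finset.sum_congr rfl fun _ _ => by ring

lemma star_sub_dotProduct_sub_of_unit {f g : Q → ℂ} (hg : star g ⬝ᵥ g = 1)
    (hgf : star g ⬝ᵥ f = 1) : star (f - g) ⬝ᵥ (f - g) = star f ⬝ᵥ f - 1 := by
  have : star f ⬝ᵥ g = 1 := by
    have := star_dotProduct_star f (star g)
    rw [star_star] at this
    rw [this, hgf, star_one]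
  rw [star_sub, sub_dotProduct, dotProduct_sub, dotProduct_sub, this, hg, hgf]
  ring

lemma exists_normalization {a : Q → ℂ} (ha : a ≠ 0) :
    ∃ c : ℂ, c ≠ 0 ∧ star (c • a) ⬝ᵥ (c • a) = 1 := by
  have hpos : 0 < star a ⬝ᵥ a := dotProduct_star_self_pos_iff.2 ha
  obtain ⟨hre, him⟩ := Complex.lt_def.1 hpos
  set r := (star a ⬝ᵥ a).re with hr
  have hr' : star a ⬝ᵥ a = (r : ℂ) := Complex.ext rfl him.symm
  have hre : 0 < r := hre
  refine ⟨((√r)⁻¹ : ℝ), by simpa using (Real.sqrt_pos.2 hre).ne', ?_⟩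
  rw [star_smul, smul_dotProduct, dotProduct_smul, hr']
  simp only [Complex.star_def, Complex.conj_ofReal, smul_eq_mul]
  norm_cast
  have := Real.mul_self_sqrt hre.le
  have h0 := (Real.sqrt_pos.2 hre).ne'
  field_simp
  nlinarith

lemma norm_dotProduct_comm (a b : Q → ℂ) : ‖star b ⬝ᵥ a‖ = ‖star a ⬝ᵥ b‖ := by
  have := star_dotProduct_star a (star b)
  rw [star_star] at this
  rw [this, norm_star]

end Sums

/-- The unit product input `r ⊗ s`, with `s` in the support of the safe state, is sent to the
unit product output `a ⊗ b`. -/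
structure ProductVector {ι κ α β : Type*} [Fintype ι] [Fintype κ] [Fintype α] [Fintype β]
    (x : ι → κ → α → β → ℂ) (l : κ → ℝ) (r : ι → ℂ) (s : κ → ℂ) (a : α → ℂ) (b : β → ℂ) :
    Prop where
  r_unit : star r ⬝ᵥ r = 1
  s_unit : star s ⬝ᵥ s = 1
  a_unit : star a ⬝ᵥ a = 1
  b_unit : star b ⬝ᵥ b = 1
  supp : ∀ k, s k ≠ 0 → l k ≠ 0
  map : ∀ m n, ∑ p : ι × κ, r p.1 * s p.2 * x p.1 p.2 m n = a m * b n

/-- The output on every pure input is a mixture of product vectors, pulled back to the safe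
system. -/
def SeparableOutputs {ι κ α β : Type*} [Fintype ι] [Fintype κ] [DecidableEq κ]
    (x : ι → κ → α → β → ℂ) (l : κ → ℝ) : Prop :=
  ∀ v : ι → ℂ, star v ⬝ᵥ v = 1 →
    ∃ (J : Type) (_ : Fintype J) (s : J → κ → ℂ) (a : J → α → ℂ) (b : J → β → ℂ),
      (∀ j m n, ∑ p : ι × κ, v p.1 * s j p.2 * x p.1 p.2 m n = a j m * b j n) ∧
      ∀ k k', ∑ j, s j k * star (s j k') = if k = k' then (l k : ℂ) else 0

section Outputs

variable {J κ : Type*} [Fintype J] [Fintype κ] [DecidableEq κ] {s : J → κ → ℂ} {l : κ → ℝ}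

omit [Fintype κ] in
lemma support_of_resolution
    (hs : ∀ k k', ∑ j, s j k * star (s j k') = if k = k' then (l k : ℂ) else 0) (j : J) (k : κ)
    (hj : s j k ≠ 0) : l k ≠ 0 := by
  intro hk
  have h1 := hs k k
  simp only [Complex.star_def, Complex.mul_conj', if_true, hk] at h1
  have h2 : ∑ j, ‖s j k‖ ^ 2 = 0 := by exact_mod_cast h1
  rw [Finset.sum_eq_zero_iff_of_nonneg fun j _ => sq_nonneg _] at h2
  exact hj (by simpa using h2 j (Finset.mem_univ _))

lemma exists_dotProduct_ne_zero
    (hs : ∀ k k', ∑ j, s j k * star (s j k') = if k = k' then (l k : ℂ) else 0) {z : κ → ℂ}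
    {k : κ} (hz : z k ≠ 0) (hk : l k ≠ 0) : ∃ j, star (s j) ⬝ᵥ z ≠ 0 := by
  by_contra! hc
  have h1 : ∑ j, s j k * (star (s j) ⬝ᵥ z) = l k * z k := by
    simp only [dotProduct, Finset.mul_sum, Pi.star_apply]
    rw [Finset.sum_comm]
    simp_rw [← mul_assoc, ← Finset.sum_mul, hs]
    simp
  simp only [hc, mul_zero, Finset.sum_const_zero] at h1
  rcases mul_eq_zero.1 h1.symm with h | h
  · exact hk (by exact_mod_cast h)
  · exact hz h

end Outputs

namespace ProductVector

variable {ι κ α β : Type*} [Fintype ι] [Fintype κ] [Fintype α] [Fintype β]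
  [DecidableEq ι] [DecidableEq κ] [DecidableEq α] [DecidableEq β]
  {x : ι → κ → α → β → ℂ} {l : κ → ℝ} {μ : α → ℝ} {ν : β → ℝ}
  {r r' : ι → ℂ} {s s' : κ → ℂ} {a a' : α → ℂ} {b b' : β → ℂ}

omit [DecidableEq ι] [DecidableEq κ] [DecidableEq α] [DecidableEq β] in
lemma swap (h : ProductVector x l r s a b) :
    ProductVector (fun i k n m => x i k m n) l r s b a where
  r_unit := h.r_unit
  s_unit := h.s_unit
  a_unit := h.b_unit
  b_unit := h.a_unit
  supp := h.supp
  map n m := by rw [h.map m n, mul_comm]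

end ProductVector

lemma MaskTensor.dotProduct_mul {ι κ α β : Type*} [Fintype ι] [Fintype κ] [Fintype α] [Fintype β]
    [DecidableEq ι] [DecidableEq κ] [DecidableEq α] [DecidableEq β]
    {x : ι → κ → α → β → ℂ} {l : κ → ℝ} {μ : α → ℝ} {ν : β → ℝ}
    {r r' : ι → ℂ} {s s' : κ → ℂ} {a a' : α → ℂ} {b b' : β → ℂ} (hx : MaskTensor x l μ ν)
    (h : ∀ m n, ∑ p : ι × κ, r p.1 * s p.2 * x p.1 p.2 m n = a m * b n)
    (h' : ∀ m n, ∑ p : ι × κ, r' p.1 * s' p.2 * x p.1 p.2 m n = a' m * b' n) :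
    (star r ⬝ᵥ r') * (star s ⬝ᵥ s') = (star a ⬝ᵥ a') * (star b ⬝ᵥ b') := by
  have h1 := sum_star_mul_of_isometry (P := ι × κ) (Q := α × β)
    (G := fun p q => x p.1 p.2 q.1 q.2) (e := 1) (S := fun _ => True)
    (y := fun p => r p.1 * s p.2) (y' := fun p => r' p.1 * s' p.2)
    (fun p p' _ _ => hx.isometry p p') (fun _ _ => trivial) (fun _ _ => trivial)
  simp only [h, h', Pi.one_apply, mul_one] at h1
  rw [sum_star_prod_mul_prod, sum_star_prod_mul_prod] at h1
  exact h1.symm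

namespace ProductVector

variable {ι κ α β : Type*} [Fintype ι] [Fintype κ] [Fintype α] [Fintype β]
  [DecidableEq ι] [DecidableEq κ] [DecidableEq α] [DecidableEq β]
  {x : ι → κ → α → β → ℂ} {l : κ → ℝ} {μ : α → ℝ} {ν : β → ℝ}
  {r r' : ι → ℂ} {s s' : κ → ℂ} {a a' : α → ℂ} {b b' : β → ℂ}

lemma of_map (hx : MaskTensor x l μ ν) (hr : star r ⬝ᵥ r = 1) (hs : s ≠ 0)
    (hsupp : ∀ k, s k ≠ 0 → l k ≠ 0)
    (hmap : ∀ m n, ∑ p : ι × κ, r p.1 * s p.2 * x p.1 p.2 m n = a m * b n) :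
    ∃ c₁ c₂ : ℂ, c₁ ≠ 0 ∧ c₂ ≠ 0 ∧
      ProductVector x l r ((c₁ * c₂) • s) (c₁ • a) (c₂ • b) := by
  have h1 := hx.dotProduct_mul hmap hmap
  have h2 : star s ⬝ᵥ s ≠ 0 := fun h => hs (dotProduct_star_self_eq_zero.1 h)
  rw [hr, one_mul] at h1
  have ha : a ≠ 0 := by rintro rfl; simp [h1] at h2
  have hb : b ≠ 0 := by rintro rfl; simp [h1] at h2
  obtain ⟨c₁, hc₁, ha⟩ := exists_normalization ha
  obtain ⟨c₂, hc₂, hb⟩ := exists_normalization hb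
  have hmap' : ∀ m n, ∑ p : ι × κ, r p.1 * ((c₁ * c₂) • s) p.2 * x p.1 p.2 m n =
      (c₁ • a) m * (c₂ • b) n := by
    intro m n
    simp only [Pi.smul_apply, smul_eq_mul]
    rw [show c₁ * a m * (c₂ * b n) = c₁ * c₂ * (a m * b n) by ring, ← hmap, Finset.mul_sum]
    exact Finset.sum_congr rfl fun p _ => by ring
  have h3 := hx.dotProduct_mul hmap' hmap'
  rw [hr, ha, hb, one_mul, one_mul] at h3
  exact ⟨c₁, c₂, hc₁, hc₂, hr, h3, ha, hb, fun k hk => hsupp k (by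
    simp only [Pi.smul_apply, smul_eq_mul] at hk
    exact right_ne_zero_of_mul hk), hmap'⟩

omit [DecidableEq ι] [DecidableEq κ] [DecidableEq α] [DecidableEq β] in
lemma exists_ne_zero (h : ProductVector x l r s a b) {m : α} {n : β} (hm : a m ≠ 0)
    (hn : b n ≠ 0) : ∃ i k, l k ≠ 0 ∧ x i k m n ≠ 0 := by
  by_contra! hc
  have h1 := h.map m n
  rw [Finset.sum_eq_zero] at h1
  · exact mul_ne_zero hm hn h1.symm
  · intro p _
    by_cases hs : s p.2 = 0
    · simp [hs]
    · rw [hc _ _ (h.supp _ hs), mul_zero]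

lemma spectrum_const (hx : MaskTensor x l μ ν) (hl : ∀ k, l k ≠ 0 → l k * Fintype.card ι = 1)
    (h : ProductVector x l r s a b) {m m' : α} (hm : a m ≠ 0) (hm' : a m' ≠ 0) : μ m = μ m' := by
  obtain ⟨n, hn⟩ : ∃ n, b n ≠ 0 := by
    by_contra! hc
    have : b = 0 := funext hc
    simpa [this] using h.b_unit
  obtain ⟨i, k, hk, hxk⟩ := h.exists_ne_zero hm hn
  obtain ⟨i', k', hk', hxk'⟩ := h.exists_ne_zero hm' hn
  rw [hx.spectra_match (hl k hk) hxk, hx.spectra_match (hl k' hk') hxk']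

/-- The tensor contracted with `s ⊗ ā`. -/
def contract (x : ι → κ → α → β → ℂ) (s : κ → ℂ) (a : α → ℂ) (q : ι × β) : ℂ :=
  ∑ p : κ × α, s p.1 * star (a p.2) * x q.1 p.1 p.2 q.2

omit [DecidableEq ι] [DecidableEq κ] [DecidableEq α] [DecidableEq β] in
lemma dotProduct_contract (h : ProductVector x l r s a b) :
    star (fun q : ι × β => star r q.1 * b q.2) ⬝ᵥ contract x s a = 1 := by
  have h1 := sum_star_prod_mul_prod a a b b
  rw [h.a_unit, h.b_unit, one_mul] at h1
  rw [← h1]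
  have h2 : ∀ q : α × β, star (a q.1 * b q.2) * (a q.1 * b q.2) = ∑ p : ι × κ,
      star (a q.1 * b q.2) * (r p.1 * s p.2 * x p.1 p.2 q.1 q.2) := fun q => by
    rw [← Finset.mul_sum, h.map]
  simp_rw [h2, dotProduct, contract, Finset.mul_sum]
  rw [← Fintype.sum_prod_type', ← Fintype.sum_prod_type']
  refine Fintype.sum_equiv (⟨fun t => ((t.2.2, t.1.2), (t.1.1, t.2.1)),
    fun t => ((t.2.1, t.1.2), (t.2.2, t.1.1)), fun _ => rfl, fun _ => rfl⟩ :
      (ι × β) × (κ × α) ≃ (α × β) × (ι × κ)) _ _ fun t => ?_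
  simp only [Pi.star_apply, star_mul', star_star, Equiv.coe_fn_mk]
  ring

lemma contract_dotProduct_contract (hx : MaskTensor x l μ ν)
    (hl : ∀ k, l k ≠ 0 → l k * Fintype.card ι = 1) (h : ProductVector x l r s a b)
    (h' : ProductVector x l r' s' a' b') :
    star (contract x s a) ⬝ᵥ contract x s' a' =
      ∑ p : κ × α, star (s p.1 * star (a p.2)) * (s' p.1 * star (a' p.2)) *
        ((Fintype.card ι * μ p.2 : ℝ) : ℂ) :=
  sum_star_mul_of_isometry (P := κ × α) (Q := ι × β)
    (G := fun p q => x q.1 p.1 p.2 q.2) (e := fun p => ((Fintype.card ι * μ p.2 : ℝ) : ℂ))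
    (S := fun p => l p.1 ≠ 0)
    (y := fun p => s p.1 * star (a p.2)) (y' := fun p => s' p.1 * star (a' p.2))
    (fun p p' hp hp' => hx.swap.isometry_snd hl p p' hp hp')
    (fun _ hp => h.supp _ (left_ne_zero_of_mul hp))
    (fun _ hp => h'.supp _ (left_ne_zero_of_mul hp))

omit [DecidableEq ι] [DecidableEq κ] [DecidableEq α] [DecidableEq β] in
lemma conj_prod_unit (h : ProductVector x l r s a b) :
    star (fun q : ι × β => star r q.1 * b q.2) ⬝ᵥ (fun q : ι × β => star r q.1 * b q.2) = 1 := by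
  refine (sum_star_prod_mul_prod (star r) (star r) b b).trans ?_
  rw [h.b_unit, star_star, mul_one, dotProduct_comm, h.r_unit]

lemma one_le_spectrum (hx : MaskTensor x l μ ν)
    (hl : ∀ k, l k ≠ 0 → l k * Fintype.card ι = 1) (h : ProductVector x l r s a b) {m : α}
    (hm : a m ≠ 0) : 1 ≤ Fintype.card ι * μ m := by
  have h1 := contract_dotProduct_contract hx hl h h
  have h2 : ∀ p : κ × α, star (s p.1 * star (a p.2)) * (s p.1 * star (a p.2)) *
        ((Fintype.card ι * μ p.2 : ℝ) : ℂ) =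
      star (s p.1 * star a p.2) * (s p.1 * star a p.2) * ((Fintype.card ι * μ m : ℝ) : ℂ) := by
    intro p
    by_cases hp : a p.2 = 0
    · simp [hp]
    · rw [h.spectrum_const hx hl hp hm, Pi.star_apply]
  have h3 := sum_star_prod_mul_prod s s (star a) (star a)
  rw [star_star, dotProduct_comm a, h.a_unit, h.s_unit, one_mul] at h3
  rw [Finset.sum_congr rfl fun p _ => h2 p, ← Finset.sum_mul, h3, one_mul] at h1
  have h4 := star_sub_dotProduct_sub_of_unit h.conj_prod_unit h.dotProduct_contract
  have h5 := dotProduct_star_self_nonneg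
    (contract x s a - fun q : ι × β => star r q.1 * b q.2)
  rw [h4, h1] at h5
  have h6 : (0 : ℝ) ≤ Fintype.card ι * μ m - 1 := by exact_mod_cast h5
  linarith

end ProductVector

namespace MaskTensor

variable {ι κ α β : Type*} [Fintype ι] [Fintype κ] [Fintype α] [Fintype β]
  [DecidableEq ι] [DecidableEq κ] [DecidableEq α] [DecidableEq β]
  {x : ι → κ → α → β → ℂ} {l : κ → ℝ} {μ : α → ℝ} {ν : β → ℝ}

omit [Fintype α] [Fintype β] [DecidableEq ι] [DecidableEq α] [DecidableEq β] in
lemma _root_.SeparableOutputs.swap (h : SeparableOutputs x l) :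
    SeparableOutputs (fun i k n m => x i k m n) l := by
  intro v hv
  obtain ⟨J, hJ, s, a, b, h1, h2⟩ := h v hv
  exact ⟨J, hJ, s, b, a, fun j n m => by rw [h1 j m n, mul_comm], h2⟩

lemma one_le_marginal [Nonempty ι] (hx : MaskTensor x l μ ν)
    (hl : ∀ k, l k ≠ 0 → l k * Fintype.card ι = 1) (hsep : SeparableOutputs x l) {m : α}
    (hm : μ m ≠ 0) : 1 ≤ Fintype.card ι * μ m := by
  obtain ⟨i⟩ := ‹Nonempty ι›
  obtain ⟨⟨k, n⟩, hkn⟩ : ∃ p : κ × β, l p.1 * ‖x i p.1 m p.2‖ ^ 2 ≠ 0 := by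
    by_contra! hc
    exact hm (by rw [← hx.sum_norm_sq_fst i m, Finset.sum_eq_zero fun p _ => hc p])
  have hk : l k ≠ 0 := left_ne_zero_of_mul hkn
  have hxk : x i k m n ≠ 0 := by simpa [hk] using hkn
  have hv : star (Pi.single i 1 : ι → ℂ) ⬝ᵥ Pi.single i 1 = 1 := by simp
  obtain ⟨J, hJ, s, a, b, h1, h2⟩ := hsep _ hv
  obtain ⟨j, hj⟩ := exists_dotProduct_ne_zero h2 (z := fun k => star (x i k m n))
    (star_ne_zero.2 hxk) hk
  have h3 : a j m * b j n ≠ 0 := by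
    rw [← h1, Fintype.sum_prod_type, Finset.sum_eq_single i]
    · intro h0
      apply hj
      have h5 : star (star (s j) ⬝ᵥ fun k => star (x i k m n)) = 0 := by
        rw [← h0]
        simp [dotProduct, star_sum]
      exact star_eq_zero.1 h5
    · intro i' _ hne
      simp [hne]
    · simp
  have hs : s j ≠ 0 := by
    intro h0
    simp [h0] at hj
  obtain ⟨c₁, c₂, hc₁, -, hP⟩ := ProductVector.of_map hx hv hs
    (support_of_resolution h2 j) (h1 j)
  exact hP.one_le_spectrum hx hl (by simpa using ⟨hc₁, left_ne_zero_of_mul h3⟩)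

lemma flat_marginal [Nonempty ι] (hx : MaskTensor x l μ ν)
    (hl : ∀ k, l k ≠ 0 → l k * Fintype.card ι = 1) (hsep : SeparableOutputs x l) {m : α}
    (hm : 1 ≤ Fintype.card ι * μ m) : Fintype.card ι * μ m = 1 := by
  refine le_antisymm ?_ hm
  have hd : (0 : ℝ) < Fintype.card ι := by exact_mod_cast Fintype.card_pos
  have h1 : Fintype.card ι * (Fintype.card ι * μ m) =
      ∑ i, ∑ k, ∑ n, l k * Fintype.card ι * ‖x i k m n‖ ^ 2 := by
    have : ∀ i, ∑ k, ∑ n, l k * Fintype.card ι * ‖x i k m n‖ ^ 2 = Fintype.card ι * μ m := by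
      intro i
      rw [← hx.sum_norm_sq_fst i m, Fintype.sum_prod_type, Finset.mul_sum]
      refine Finset.sum_congr rfl fun k _ => ?_
      rw [Finset.mul_sum]
      exact Finset.sum_congr rfl fun n _ => by ring
    simp [this]
  have h2 : ∑ i, ∑ k, ∑ n, Fintype.card ι * ν n * ‖x i k m n‖ ^ 2 = Fintype.card ι := by
    have : ∀ n, ∑ i, ∑ k, Fintype.card ι * ν n * ‖x i k m n‖ ^ 2 = Fintype.card ι * ν n := by
      intro n
      simp_rw [← Finset.mul_sum]
      rw [← Fintype.sum_prod_type' (f := fun i k => ‖x i k m n‖ ^ 2), hx.row_norm, mul_one]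
    rw [Finset.sum_congr rfl fun i _ => Finset.sum_comm, Finset.sum_comm]
    simp_rw [this, ← Finset.mul_sum, hx.ν_sum, mul_one]
  have h3 : Fintype.card ι * (Fintype.card ι * μ m) ≤ (Fintype.card ι : ℝ) * 1 := by
    rw [h1, mul_one]
    refine le_trans ?_ h2.le
    refine Finset.sum_le_sum fun i _ => Finset.sum_le_sum fun k _ => Finset.sum_le_sum fun n _ => ?_
    by_cases hk : l k = 0
    · rw [hk]
      have := hx.ν_nonneg n
      simp only [zero_mul]
      positivity
    by_cases hn : ν n = 0
    · simp [hx.eq_zero_of_snd hk hn]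
    rw [hl k hk]
    exact mul_le_mul_of_nonneg_right (hx.swap.one_le_marginal hl hsep.swap hn) (sq_nonneg _)
  exact le_of_mul_le_mul_left h3 hd

end MaskTensor

namespace ProductVector

variable {ι κ α β : Type*} [Fintype ι] [Fintype κ] [Fintype α] [Fintype β]
  [DecidableEq ι] [DecidableEq κ] [DecidableEq α] [DecidableEq β]
  {x : ι → κ → α → β → ℂ} {l : κ → ℝ} {μ : α → ℝ} {ν : β → ℝ}
  {r r' : ι → ℂ} {s s' : κ → ℂ} {a a' : α → ℂ} {b b' : β → ℂ}

section Flat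

variable [Nonempty ι] (hx : MaskTensor x l μ ν)
  (hl : ∀ k, l k ≠ 0 → l k * Fintype.card ι = 1) (hsep : SeparableOutputs x l)
include hx hl hsep

lemma contract_dotProduct_contract_of_flat (h : ProductVector x l r s a b)
    (h' : ProductVector x l r' s' a' b') :
    star (contract x s a) ⬝ᵥ contract x s' a' =
      (star s ⬝ᵥ s') * (star (star a) ⬝ᵥ star a') := by
  rw [contract_dotProduct_contract hx hl h h', ← sum_star_prod_mul_prod]
  refine Finset.sum_congr rfl fun p _ => ?_
  by_cases hp : a p.2 = 0
  · simp [hp]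
  · rw [hx.flat_marginal hl hsep (h.one_le_spectrum hx hl hp), Complex.ofReal_one, mul_one]
    rfl

lemma contract_eq (h : ProductVector x l r s a b) :
    contract x s a = fun q : ι × β => star r q.1 * b q.2 := by
  have h1 := star_sub_dotProduct_sub_of_unit h.conj_prod_unit h.dotProduct_contract
  rw [contract_dotProduct_contract_of_flat hx hl hsep h h, h.s_unit, star_star, dotProduct_comm a,
    h.a_unit, mul_one, sub_self] at h1
  exact sub_eq_zero.1 (dotProduct_star_self_eq_zero.1 h1)

lemma norm_mul_norm (h : ProductVector x l r s a b) (h' : ProductVector x l r' s' a' b') :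
    ‖star s ⬝ᵥ s'‖ * ‖star a ⬝ᵥ a'‖ = ‖star r ⬝ᵥ r'‖ * ‖star b ⬝ᵥ b'‖ := by
  have h1 := contract_dotProduct_contract_of_flat hx hl hsep h h'
  rw [contract_eq hx hl hsep h, contract_eq hx hl hsep h'] at h1
  have h2 := (sum_star_prod_mul_prod (star r) (star r') b b').symm.trans h1
  have h3 := congrArg norm h2
  rw [norm_mul, norm_mul, star_star, star_star, dotProduct_comm r, dotProduct_comm a,
    norm_dotProduct_comm r r', norm_dotProduct_comm a a'] at h3
  exact h3.symm

/-- Two product vectors overlap on the safe system either not at all or exactly as much as on the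
input system. -/
lemma overlap (h : ProductVector x l r s a b) (h' : ProductVector x l r' s' a' b')
    (hr : star r ⬝ᵥ r' ≠ 0) :
    ‖star s ⬝ᵥ s'‖ = 0 ∨ ‖star s ⬝ᵥ s'‖ = ‖star r ⬝ᵥ r'‖ := by
  have h1 := norm_mul_norm hx hl hsep h h'
  have h2 := norm_mul_norm hx.swap hl hsep.swap h.swap h'.swap
  have h3 := congrArg norm (hx.dotProduct_mul h.map h'.map)
  rw [norm_mul, norm_mul] at h3
  have ht : 0 < ‖star r ⬝ᵥ r'‖ := norm_pos_iff.2 hr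
  set t := ‖star r ⬝ᵥ r'‖
  set y := ‖star s ⬝ᵥ s'‖
  set z := ‖star a ⬝ᵥ a'‖
  set w := ‖star b ⬝ᵥ b'‖
  have hy : 0 ≤ y := norm_nonneg _
  have h4 : (y ^ 2 - t ^ 2) * z = 0 := by linear_combination y * h1 + t * h2
  rcases mul_eq_zero.1 h4 with h5 | h5
  · right
    have h6 : y ^ 2 = t ^ 2 := sub_eq_zero.1 h5
    exact (pow_left_inj₀ hy ht.le two_ne_zero).1 h6
  · left
    rw [h5, zero_mul] at h3
    exact (mul_eq_zero.1 h3).resolve_left ht.ne'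

end Flat

end ProductVector

section Bessel

variable {κ : Type*} [Fintype κ]

lemma sub_smul_dotProduct_self {e z : κ → ℂ} (he : star e ⬝ᵥ e = 1) :
    star (z - (star e ⬝ᵥ z) • e) ⬝ᵥ (z - (star e ⬝ᵥ z) • e) =
      star z ⬝ᵥ z - ((‖star e ⬝ᵥ z‖ ^ 2 : ℝ) : ℂ) := by
  have h1 : star z ⬝ᵥ e = star (star e ⬝ᵥ z) := by
    have := star_dotProduct_star z (star e)
    rw [star_star] at this
    exact this
  rw [star_sub, star_smul, sub_dotProduct, dotProduct_sub, dotProduct_sub, smul_dotProduct,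
    smul_dotProduct, dotProduct_smul, dotProduct_smul, he, h1]
  push_cast
  rw [← Complex.mul_conj']
  simp only [smul_eq_mul, Complex.star_def]
  ring

lemma eq_smul_of_norm_dotProduct_eq_one {e z : κ → ℂ} (he : star e ⬝ᵥ e = 1)
    (hz : star z ⬝ᵥ z = 1) (h : ‖star e ⬝ᵥ z‖ = 1) : z = (star e ⬝ᵥ z) • e := by
  have h1 := sub_smul_dotProduct_self (z := z) he
  rw [hz, h, one_pow, Complex.ofReal_one, sub_self] at h1
  exact sub_eq_zero.1 (dotProduct_star_self_eq_zero.1 h1)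

lemma bessel_pair {e f z : κ → ℂ} (he : star e ⬝ᵥ e = 1) (hf : star f ⬝ᵥ f = 1)
    (hef : star f ⬝ᵥ e = 0) (hz : star z ⬝ᵥ z = 1) :
    ‖star e ⬝ᵥ z‖ ^ 2 + ‖star f ⬝ᵥ z‖ ^ 2 ≤ 1 := by
  have h1 := sub_smul_dotProduct_self (z := z) he
  have h2 := sub_smul_dotProduct_self (z := z - (star e ⬝ᵥ z) • e) hf
  rw [h1, hz] at h2
  have h3 : star f ⬝ᵥ (z - (star e ⬝ᵥ z) • e) = star f ⬝ᵥ z := by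
    rw [dotProduct_sub, dotProduct_smul, hef, smul_zero, sub_zero]
  rw [h3] at h2
  have h4 := dotProduct_star_self_nonneg (z - (star e ⬝ᵥ z) • e - (star f ⬝ᵥ z) • f)
  rw [h2] at h4
  have h5 : (0 : ℝ) ≤ 1 - ‖star e ⬝ᵥ z‖ ^ 2 - ‖star f ⬝ᵥ z‖ ^ 2 := by exact_mod_cast h4
  linarith

end Bessel

/-- A masker with flat safe state of rank `d` has an entangled output. -/
theorem MaskTensor.not_separableOutputs {ι κ α β : Type*} [Fintype ι] [Fintype κ] [Fintype α]
    [Fintype β] [DecidableEq ι] [DecidableEq κ] [DecidableEq α] [DecidableEq β] [Nontrivial ι]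
    {x : ι → κ → α → β → ℂ} {l : κ → ℝ} {μ : α → ℝ} {ν : β → ℝ} (hx : MaskTensor x l μ ν)
    (hl : ∀ k, l k ≠ 0 → l k * Fintype.card ι = 1) : ¬ SeparableOutputs x l := by
  intro hsep
  obtain ⟨i₀, i₁, hi⟩ := exists_pair_ne ι
  obtain ⟨k₀, hk₀⟩ : ∃ k, l k ≠ 0 := by
    by_contra! hc
    have h1 : ∀ m, μ m = 0 := fun m => by
      rw [← hx.sum_norm_sq_fst i₀ m]
      simp [hc]
    simpa [h1] using hx.μ_sum
  set r : ι → ℂ := Pi.single i₀ 1 with hr_def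
  set r' : ι → ℂ := Pi.single i₀ (4 / 5) + Pi.single i₁ (3 / 5) with hr'_def
  have hr : star r ⬝ᵥ r = 1 := by simp [hr_def]
  have hr' : star r' ⬝ᵥ r' = 1 := by
    simp [hr'_def, hi, hi.symm, dotProduct_add]
    norm_num
  have hrr' : star r ⬝ᵥ r' = 4 / 5 := by
    simp [hr_def, hr'_def, hi]
  obtain ⟨J, hJ, s, a, b, h1, h2⟩ := hsep r hr
  obtain ⟨J', hJ', s', a', b', h1', h2'⟩ := hsep r' hr'
  obtain ⟨j', hj'⟩ := exists_dotProduct_ne_zero h2' (z := Pi.single k₀ 1) (by simp) hk₀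
  have hs' : s' j' ≠ 0 := by
    intro h0
    simp [h0] at hj'
  obtain ⟨c₁, c₂, -, -, hP'⟩ := ProductVector.of_map hx hr' hs'
    (support_of_resolution h2' j') (h1' j')
  generalize (c₁ * c₂) • s' j' = σ at hP'
  have hspan : ∀ z : κ → ℂ, z ≠ 0 → (∀ k, z k ≠ 0 → l k ≠ 0) → ∃ τ a b,
      ProductVector x l r τ a b ∧ star τ ⬝ᵥ z ≠ 0 := by
    intro z hz hzl
    obtain ⟨k, hk⟩ := Function.ne_iff.1 hz
    obtain ⟨j, hj⟩ := exists_dotProduct_ne_zero h2 (z := z) hk (hzl k hk)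
    have hs : s j ≠ 0 := by
      intro h0
      simp [h0] at hj
    obtain ⟨c₁, c₂, hc₁, hc₂, hP⟩ := ProductVector.of_map hx hr hs
      (support_of_resolution h2 j) (h1 j)
    refine ⟨_, _, _, hP, ?_⟩
    rw [star_smul, smul_dotProduct]
    exact smul_ne_zero (star_ne_zero.2 (mul_ne_zero hc₁ hc₂)) hj
  have hσ : σ ≠ 0 := by
    rintro rfl
    simpa using hP'.s_unit
  obtain ⟨e, ae, be, he, heσ⟩ := hspan σ hσ hP'.supp
  have hrr'0 : star r ⬝ᵥ r' ≠ 0 := by rw [hrr']; norm_num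
  have hnorm : ‖star r ⬝ᵥ r'‖ = 4 / 5 := by rw [hrr']; norm_num
  have heσ' : ‖star e ⬝ᵥ σ‖ = 4 / 5 :=
    ((he.overlap hx hl hsep hP' hrr'0).resolve_left (norm_ne_zero_iff.2 heσ)).trans hnorm
  have hz : σ - (star e ⬝ᵥ σ) • e ≠ 0 := by
    intro h0
    have := sub_smul_dotProduct_self (z := σ) he.s_unit
    rw [h0, hP'.s_unit, heσ'] at this
    norm_num at this
  obtain ⟨f, af, bf, hf, hfz⟩ := hspan _ hz (by
    intro k hk
    by_cases h0 : σ k = 0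
    · refine he.supp k fun h3 => hk ?_
      simp [h0, h3]
    · exact hP'.supp k h0)
  have hfe : star f ⬝ᵥ e = 0 := by
    have hrr : star r ⬝ᵥ r ≠ 0 := by rw [hr]; norm_num
    rcases hf.overlap hx hl hsep he hrr with h3 | h3
    · exact norm_eq_zero.1 h3
    · exfalso
      rw [hr, norm_one] at h3
      have h4 := eq_smul_of_norm_dotProduct_eq_one he.s_unit hf.s_unit
        ((norm_dotProduct_comm _ _).trans h3)
      apply hfz
      rw [h4, star_smul, smul_dotProduct, dotProduct_sub, dotProduct_smul, he.s_unit]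
      simp
  have hfσ : star f ⬝ᵥ σ ≠ 0 := by
    rwa [dotProduct_sub, dotProduct_smul, hfe, smul_zero, sub_zero] at hfz
  have hfσ' : ‖star f ⬝ᵥ σ‖ = 4 / 5 :=
    ((hf.overlap hx hl hsep hP' hrr'0).resolve_left (norm_ne_zero_iff.2 hfσ)).trans hnorm
  have := bessel_pair he.s_unit hf.s_unit hfe hP'.s_unit
  rw [heσ', hfσ'] at this
  norm_num at this

section Tensorization

variable {ι κ α β : Type*} [Fintype ι] [Fintype κ] [Fintype α] [Fintype β]
  [DecidableEq ι] [DecidableEq κ] [DecidableEq α] [DecidableEq β]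

omit [Fintype α] [Fintype β] [DecidableEq ι] [DecidableEq α] [DecidableEq β] in
lemma conj_kronecker_diagonal_apply (N : Matrix (α × β) (ι × κ) ℂ) (ρ : Matrix ι ι ℂ)
    (l : κ → ℂ) (q q' : α × β) :
    (N * (ρ ⊗ₖ diagonal l) * Nᴴ) q q' =
      ∑ i, ∑ j, ρ i j * ∑ k, l k * (N q (i, k) * star (N q' (j, k))) := by
  simp only [mul_apply, kroneckerMap_apply, diagonal_apply, conjTranspose_apply,
    Fintype.sum_prod_type, mul_ite, mul_zero, Finset.sum_ite_eq', Finset.mem_univ, if_true,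
    Finset.sum_mul, Finset.mul_sum]
  rw [Finset.sum_congr rfl fun j _ => Finset.sum_comm, Finset.sum_comm]
  refine Finset.sum_congr rfl fun i _ => Finset.sum_congr rfl fun j _ =>
    Finset.sum_congr rfl fun k _ => by ring

omit [Fintype ι] [DecidableEq ι] [DecidableEq κ] [DecidableEq α] in
lemma ptrace2_conj_kronecker_s1 {A : Matrix ι α ℂ} {B : Matrix κ β ℂ} (hB : Bᴴ * B = 1)
    (X : Matrix (α × β) (α × β) ℂ) :
    ptrace2 ((A ⊗ₖ B) * X * (A ⊗ₖ B)ᴴ) = A * ptrace2 X * Aᴴ := by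
  ext i i'
  have hB' : ∀ n n', ∑ j, star (B j n) * B j n' = if n = n' then 1 else 0 := fun n n' => by
    have := congrFun (congrFun hB n) n'
    simpa [mul_apply, one_apply] using this
  have h1 : ∀ j, ((A ⊗ₖ B) * X * (A ⊗ₖ B)ᴴ) (i, j) (i', j) =
      ∑ q : α × β, ∑ p : α × β, A i p.1 * X p q * star (A i' q.1) *
        (star (B j q.2) * B j p.2) := fun j => by
    simp only [mul_apply, kroneckerMap_apply, conjTranspose_apply, Finset.sum_mul, star_mul']
    exact Finset.sum_congr rfl fun q _ => Finset.sum_congr rfl fun p _ => by ring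
  simp only [ptrace2, of_apply, h1]
  rw [Finset.sum_comm, Finset.sum_congr rfl fun q _ => Finset.sum_comm]
  simp_rw [← Finset.mul_sum, hB']
  simp only [mul_apply, of_apply, conjTranspose_apply, Fintype.sum_prod_type, mul_ite, mul_one,
    mul_zero, Finset.sum_ite_eq, Finset.mem_univ, if_true, Finset.sum_mul, Finset.mul_sum]
  refine Finset.sum_congr rfl fun m _ => ?_
  rw [Finset.sum_comm]

omit [Fintype κ] [DecidableEq ι] [DecidableEq κ] [DecidableEq β] in
lemma ptrace1_conj_kronecker_s1 {A : Matrix ι α ℂ} {B : Matrix κ β ℂ} (hA : Aᴴ * A = 1)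
    (X : Matrix (α × β) (α × β) ℂ) :
    ptrace1 ((A ⊗ₖ B) * X * (A ⊗ₖ B)ᴴ) = B * ptrace1 X * Bᴴ := by
  have h1 := ptrace2_conj_kronecker_s1 (A := B) (B := A) hA (X.submatrix Prod.swap Prod.swap)
  have h2 : ptrace2 (X.submatrix Prod.swap Prod.swap) = ptrace1 X := rfl
  rw [← h2, ← h1]
  have h3 : (B ⊗ₖ A) * X.submatrix Prod.swap Prod.swap * (B ⊗ₖ A)ᴴ =
      ((A ⊗ₖ B) * X * (A ⊗ₖ B)ᴴ).submatrix (Equiv.prodComm κ ι) (Equiv.prodComm κ ι) := by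
    rw [← submatrix_mul_equiv _ _ _ (Equiv.prodComm β α) _,
      ← submatrix_mul_equiv _ _ _ (Equiv.prodComm β α) _]
    congr 1
    · congr 1
      ext p q
      simp [mul_comm]
    · ext p q
      simp [mul_comm]
  rw [h3]
  rfl

lemma isDensity_vecMulVec_self_star {n : Type*} [Fintype n] {v : n → ℂ}
    (hv : star v ⬝ᵥ v = 1) : IsDensity (vecMulVec v (star v)) :=
  ⟨posSemidef_vecMulVec_self_star v, by rw [trace_vecMulVec, dotProduct_comm, hv]⟩

/-- A sesquilinear form constant on density matrices is a multiple of the trace form. -/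
lemma eq_ite_of_density {c : ι → ι → ℂ} {e : ℂ}
    (h : ∀ ρ : Matrix ι ι ℂ, IsDensity ρ → ∑ i, ∑ j, ρ i j * c i j = e) (i j : ι) :
    c i j = if i = j then e else 0 := by
  have hpure : ∀ v : ι → ℂ, star v ⬝ᵥ v = 1 → ∑ i, v i * ∑ j, star v j * c i j = e := by
    intro v hv
    rw [← h _ (isDensity_vecMulVec_self_star hv)]
    simp only [vecMulVec_apply, mul_assoc, Finset.mul_sum]
  have hdiag : ∀ i, c i i = e := by
    intro i
    rw [← hpure (Pi.single i 1) (by simp)]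
    simp [Pi.single_apply, apply_ite]
  split_ifs with hij
  · subst hij
    exact hdiag i
  obtain ⟨r, hr⟩ : ∃ r : ℂ, r * star r = 1 / 2 := by
    refine ⟨(√(1 / 2) : ℝ), ?_⟩
    rw [Complex.star_def, Complex.conj_ofReal, ← Complex.ofReal_mul,
      Real.mul_self_sqrt (by norm_num)]
    norm_num
  have key : ∀ z : ℂ, z * star z = 1 → star z * c i j + z * c j i = 0 := by
    intro z hz
    obtain ⟨v, hv⟩ : ∃ v : ι → ℂ, v = Pi.single i r + Pi.single j (r * z) := ⟨_, rfl⟩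
    have h2 : ∀ f : ι → ℂ, ∑ t, v t * f t = r * f i + r * z * f j := fun f => by
      simp [hv, add_mul, Finset.sum_add_distrib, Pi.single_apply]
    have h3 : ∀ f : ι → ℂ, ∑ t, star v t * f t = star r * f i + star r * star z * f j :=
      fun f => by
        have h4 := congrArg star (h2 fun t => star (f t))
        simpa only [Pi.star_apply, star_sum, star_add, star_mul', star_star] using h4
    have hi : v i = r := by simp [hv, hij]
    have hj : v j = r * z := by simp [hv, Ne.symm hij]
    have h1 := hpure v (by
      rw [dotProduct, h3, hi, hj]
      linear_combination (1 + z * star z) * hr + hz / 2)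
    rw [h2, h3, h3, hdiag, hdiag] at h1
    linear_combination 2 * h1 - e * hz -
      2 * (e + star z * c i j + z * c j i + z * star z * e) * hr
  have h1 := key 1 (by simp)
  have h2 := key Complex.I (by simp)
  simp only [star_one, one_mul, Complex.star_def, Complex.conj_I] at h1 h2
  have h3 : 2 * Complex.I * c i j = 0 := by linear_combination Complex.I * h1 - h2
  simpa using h3

lemma IsDensity.exists_diagonalization {n : Type*} [Fintype n] [DecidableEq n]
    {σ : Matrix n n ℂ} (hσ : IsDensity σ) :
    ∃ U : Matrix n n ℂ, Uᴴ * U = 1 ∧ U * Uᴴ = 1 ∧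
      Uᴴ * σ * U = diagonal (fun i => ((hσ.1.isHermitian.eigenvalues i : ℝ) : ℂ)) ∧
      (∀ i, 0 ≤ hσ.1.isHermitian.eigenvalues i) ∧ ∑ i, hσ.1.isHermitian.eigenvalues i = 1 := by
  set h := hσ.1.isHermitian
  obtain ⟨U, hUdef⟩ : ∃ U : Matrix n n ℂ, U = h.eigenvectorUnitary.1 := ⟨_, rfl⟩
  have hU : Uᴴ * U = 1 := hUdef ▸ Unitary.coe_star_mul_self h.eigenvectorUnitary
  have hU' : U * Uᴴ = 1 := hUdef ▸ Unitary.coe_mul_star_self h.eigenvectorUnitary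
  refine ⟨U, hU, hU', ?_, hσ.1.eigenvalues_nonneg, ?_⟩
  · have h1 := h.spectral_theorem
    rw [Unitary.conjStarAlgAut_apply] at h1
    have h2 : σ = U * diagonal (fun i => ((h.eigenvalues i : ℝ) : ℂ)) * Uᴴ := hUdef ▸ h1
    generalize h.eigenvalues = e at h2
    rw [h2]
    rw [Matrix.mul_assoc, Matrix.mul_assoc, hU, Matrix.mul_one, ← Matrix.mul_assoc, hU,
      Matrix.one_mul]
  · have h1 := h.trace_eq_sum_eigenvalues
    rw [hσ.2] at h1
    exact (Complex.ofReal_injective (by simpa using h1)).symm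

omit [DecidableEq α] [DecidableEq β] in
/-- A decomposition of the output on a pure input pulls back to a decomposition of the safe
state. -/
lemma exists_resolution {N : Matrix (α × β) (ι × κ) ℂ} [DecidableEq (α × β)] (hN : N * Nᴴ = 1)
    (hN' : Nᴴ * N = 1) {l : κ → ℂ} {v : ι → ℂ} (hv : star v ⬝ᵥ v = 1) {J : Type*} [Fintype J]
    {w : J → α × β → ℂ}
    (hΦ : N * (vecMulVec v (star v) ⊗ₖ diagonal l) * Nᴴ =
      ∑ j, vecMulVec (w j) (star (w j))) :
    ∃ s : J → κ → ℂ, (∀ j q, ∑ p : ι × κ, v p.1 * s j p.2 * N q p = w j q) ∧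
      ∀ k k', ∑ j, s j k * star (s j k') = if k = k' then l k else 0 := by
  set t : J → ι × κ → ℂ := fun j => Nᴴ *ᵥ w j with ht
  have h1 : vecMulVec v (star v) ⊗ₖ diagonal l = ∑ j, vecMulVec (t j) (star (t j)) := by
    have h2 : Nᴴ * (N * (vecMulVec v (star v) ⊗ₖ diagonal l) * Nᴴ) * N =
        vecMulVec v (star v) ⊗ₖ diagonal l := by
      rw [Matrix.mul_assoc, Matrix.mul_assoc, hN', Matrix.mul_one, ← Matrix.mul_assoc, hN',
        Matrix.one_mul]
    rw [← h2, hΦ, Matrix.mul_sum, Matrix.sum_mul]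
    refine Finset.sum_congr rfl fun j _ => ?_
    rw [mul_vecMulVec, vecMulVec_mul, ht]
    simp only [star_mulVec, conjTranspose_conjTranspose]
  have h2 : ∀ i k i' k', ∑ j, t j (i, k) * star (t j (i', k')) =
      v i * star (v i') * if k = k' then l k else 0 := fun i k i' k' => by
    have := congrFun (congrFun h1 (i, k)) (i', k')
    simp only [kroneckerMap_apply, vecMulVec_apply, diagonal_apply, Matrix.sum_apply,
      Pi.star_apply] at this
    exact this.symm
  set s : J → κ → ℂ := fun j k => ∑ i, star (v i) * t j (i, k) with hs
  have hv1 : ∑ i, star (v i) * v i = 1 := hv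
  have hv2 : ∑ i, v i * star (v i) = 1 := by simpa only [mul_comm] using hv1
  have h3 : ∀ i k k', ∑ j, t j (i, k) * star (s j k') = v i * if k = k' then l k else 0 := by
    intro i k k'
    simp only [hs, star_sum, star_mul', star_star, Finset.mul_sum]
    rw [Finset.sum_comm]
    simp_rw [mul_left_comm, ← Finset.mul_sum, h2]
    rw [← one_mul (v i * _), ← hv2, Finset.sum_mul]
    exact Finset.sum_congr rfl fun _ _ => by ring
  have h4 : ∀ k k', ∑ j, s j k * star (s j k') = if k = k' then l k else 0 := by
    intro k k'
    rw [← one_mul (if k = k' then l k else 0), ← hv1, Finset.sum_mul]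
    conv_lhs => enter [2, j, 1]; rw [hs]
    simp only [Finset.sum_mul]
    rw [Finset.sum_comm]
    simp_rw [mul_assoc, ← Finset.mul_sum, h3]
  have h5 : ∀ j p, t j p = v p.1 * s j p.2 := by
    rintro j ⟨i, k⟩
    have h6 : ∑ j, (t j (i, k) - v i * s j k) * star (t j (i, k) - v i * s j k) = 0 := by
      have h7 : ∑ j, s j k * star (t j (i, k)) = star (v i) * l k := by
        conv_lhs => enter [2, j, 1]; rw [hs]
        simp only [Finset.sum_mul]
        rw [Finset.sum_comm]
        simp_rw [mul_assoc, ← Finset.mul_sum, h2]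
        rw [← one_mul (star (v i) * l k), ← hv1, Finset.sum_mul]
        exact Finset.sum_congr rfl fun _ _ => by simp; ring
      have h8 : ∀ j, (t j (i, k) - v i * s j k) * star (t j (i, k) - v i * s j k) =
          t j (i, k) * star (t j (i, k)) - star (v i) * (t j (i, k) * star (s j k)) -
          v i * (s j k * star (t j (i, k))) + v i * star (v i) * (s j k * star (s j k)) := by
        intro j
        rw [star_sub, star_mul']
        ring
      simp_rw [h8, Finset.sum_add_distrib, Finset.sum_sub_distrib, ← Finset.mul_sum, h2, h3, h4,
        h7, if_true]
      ring
    simp only [Complex.star_def, Complex.mul_conj'] at h6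
    have h9 : ∑ j, ‖t j (i, k) - v i * s j k‖ ^ 2 = 0 := by exact_mod_cast h6
    rw [Finset.sum_eq_zero_iff_of_nonneg fun j _ => sq_nonneg _] at h9
    exact sub_eq_zero.1 (by simpa using h9 j (Finset.mem_univ _))
  refine ⟨s, fun j q => ?_, h4⟩
  have h6 : N *ᵥ t j = w j := by rw [ht, mulVec_mulVec, hN, one_mulVec]
  rw [← h6]
  simp only [mulVec, dotProduct, h5]
  exact Finset.sum_congr rfl fun p _ => by ring

open scoped MatrixOrder in
omit [DecidableEq α] in
lemma Matrix.PosSemidef.exists_conjTranspose_mul_self {A : Matrix α α ℂ}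
    (hA : A.PosSemidef) : ∃ C : Matrix α α ℂ, A = Cᴴ * C := by
  classical
  exact CStarAlgebra.nonneg_iff_eq_star_mul_self.mp hA.nonneg

omit [DecidableEq α] [DecidableEq β] in
lemma kronecker_eq_sum_vecMulVec {A : Matrix α α ℂ} {B : Matrix β β ℂ} (hA : A.PosSemidef)
    (hB : B.PosSemidef) {p : ℝ} (hp : 0 ≤ p) :
    ∃ (a : α → α → ℂ) (b : β → β → ℂ), (p : ℂ) • (A ⊗ₖ B) =
      ∑ j : α × β, vecMulVec (fun q : α × β => a j.1 q.1 * b j.2 q.2)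
        (star fun q : α × β => a j.1 q.1 * b j.2 q.2) := by
  classical
  obtain ⟨C, rfl⟩ := hA.exists_conjTranspose_mul_self
  obtain ⟨D, rfl⟩ := hB.exists_conjTranspose_mul_self
  have hs : star ((√p : ℝ) : ℂ) = (√p : ℝ) := Complex.conj_ofReal _
  have hp' : ((√p : ℝ) : ℂ) * (√p : ℝ) = p := by exact_mod_cast Real.mul_self_sqrt hp
  refine ⟨fun t m => (√p : ℝ) * star (C t m), fun u n => star (D u n), ?_⟩
  ext q q'
  simp only [Matrix.smul_apply, smul_eq_mul, kroneckerMap_apply, mul_apply, conjTranspose_apply,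
    Matrix.sum_apply, vecMulVec_apply, Pi.star_apply, star_mul', star_star,
    Fintype.sum_prod_type, hs]
  rw [Finset.sum_mul_sum, Finset.mul_sum]
  refine Finset.sum_congr rfl fun i _ => ?_
  rw [Finset.mul_sum]
  refine Finset.sum_congr rfl fun j _ => ?_
  rw [← hp']
  ring

end Tensorization

section Assembly

variable {ι κ α β : Type*} [Fintype ι] [Fintype κ] [Fintype α] [Fintype β]
  [DecidableEq ι] [DecidableEq κ] [DecidableEq α] [DecidableEq β]

lemma maskTensor_of_ptrace {N : Matrix (α × β) (ι × κ) ℂ} (hN : Nᴴ * N = 1) (hN' : N * Nᴴ = 1)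
    {l : κ → ℝ} {μ : α → ℝ} {ν : β → ℝ} (hl : ∀ k, 0 ≤ l k) (hμ : ∀ m, 0 ≤ μ m)
    (hν : ∀ n, 0 ≤ ν n) (hμ1 : ∑ m, μ m = 1) (hν1 : ∑ n, ν n = 1)
    (h2 : ∀ ρ : Matrix ι ι ℂ, IsDensity ρ →
      ptrace2 (N * (ρ ⊗ₖ diagonal fun k => (l k : ℂ)) * Nᴴ) = diagonal fun m => (μ m : ℂ))
    (h1 : ∀ ρ : Matrix ι ι ℂ, IsDensity ρ →
      ptrace1 (N * (ρ ⊗ₖ diagonal fun k => (l k : ℂ)) * Nᴴ) = diagonal fun n => (ν n : ℂ)) :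
    MaskTensor (fun i k m n => N (m, n) (i, k)) l μ ν where
  l_nonneg := hl
  μ_nonneg := hμ
  ν_nonneg := hν
  μ_sum := hμ1
  ν_sum := hν1
  isometry p p' := by
    have h := congrFun (congrFun hN p) p'
    simpa only [mul_apply, conjTranspose_apply, one_apply] using h
  row_norm m n := by
    have h := congrFun (congrFun hN' (m, n)) (m, n)
    simp only [mul_apply, conjTranspose_apply, one_apply_eq, Complex.star_def,
      Complex.mul_conj'] at h
    exact_mod_cast h
  marginal_fst := by
    rintro ⟨i, m⟩ ⟨i', m'⟩
    have h := eq_ite_of_density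
      (c := fun a b => ∑ n, ∑ k, (l k : ℂ) * (N (m', n) (a, k) * star (N (m, n) (b, k))))
      (e := diagonal (fun m => (μ m : ℂ)) m' m) (fun ρ hρ => by
        rw [← h2 ρ hρ]
        simp only [ptrace2, of_apply, conj_kronecker_diagonal_apply]
        symm
        rw [Finset.sum_comm]
        refine Finset.sum_congr rfl fun i _ => ?_
        rw [Finset.sum_comm]
        simp only [Finset.mul_sum]) i' i
    rw [Fintype.sum_prod_type, Finset.sum_comm]
    simp only [diagonal_apply] at h
    simp only [mul_comm (star _), h, Prod.mk.injEq]
    grind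
  marginal_snd := by
    rintro ⟨i, n⟩ ⟨i', n'⟩
    have h := eq_ite_of_density
      (c := fun a b => ∑ m, ∑ k, (l k : ℂ) * (N (m, n') (a, k) * star (N (m, n) (b, k))))
      (e := diagonal (fun n => (ν n : ℂ)) n' n) (fun ρ hρ => by
        rw [← h1 ρ hρ]
        simp only [ptrace1, of_apply, conj_kronecker_diagonal_apply]
        symm
        rw [Finset.sum_comm]
        refine Finset.sum_congr rfl fun i _ => ?_
        rw [Finset.sum_comm]
        simp only [Finset.mul_sum]) i' i
    rw [Fintype.sum_prod_type, Finset.sum_comm]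
    simp only [diagonal_apply] at h
    simp only [mul_comm (star _), h, Prod.mk.injEq]
    grind

/-- If all outputs on pure inputs are separable, the tensor has separable outputs. -/
lemma separableOutputs_of_decomposition {α β : Type} [Fintype α] [Fintype β] [DecidableEq α]
    [DecidableEq β] {N : Matrix (α × β) (ι × κ) ℂ} (hN : Nᴴ * N = 1)
    (hN' : N * Nᴴ = 1) {l : κ → ℝ}
    (h : ∀ ρ : Matrix ι ι ℂ, IsDensity ρ →
      ∃ (r : ℕ) (p : Fin r → ℝ) (A : Fin r → Matrix α α ℂ) (B : Fin r → Matrix β β ℂ),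
        (∀ k, 0 ≤ p k) ∧ (∀ k, (A k).PosSemidef) ∧ (∀ k, (B k).PosSemidef) ∧
        N * (ρ ⊗ₖ diagonal fun k => (l k : ℂ)) * Nᴴ = ∑ k, (p k : ℂ) • (A k ⊗ₖ B k)) :
    SeparableOutputs (fun i k m n => N (m, n) (i, k)) l := by
  intro v hv
  obtain ⟨r, p, A, B, hp, hA, hB, hΦ⟩ := h _ (isDensity_vecMulVec_self_star hv)
  choose a b hab using fun k => kronecker_eq_sum_vecMulVec (hA k) (hB k) (hp k)
  obtain ⟨s, hs, hres⟩ := exists_resolution hN' hN hv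
    (w := fun (j : Fin r × (α × β)) (q : α × β) => a j.1 j.2.1 q.1 * b j.1 j.2.2 q.2) (by
      rw [hΦ, Fintype.sum_prod_type]
      exact Finset.sum_congr rfl fun k _ => hab k)
  exact ⟨_, inferInstance, s, fun j => a j.1 j.2.1, fun j => b j.1 j.2.2,
    fun j m n => hs j (m, n), hres⟩

end Assembly

/-- A probability vector with entries at most `1 / d`, not all in `{0, 1 / d}`, has Shannon
entropy greater than `log₂ d`. -/
lemma logb_lt_entropy {κ : Type*} [Fintype κ] {l : κ → ℝ} {d : ℝ} (hd : 0 < d)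
    (hl : ∀ k, 0 ≤ l k) (hl1 : ∑ k, l k = 1) (hle : ∀ k, l k * d ≤ 1) {k₀ : κ} (hk₀ : l k₀ ≠ 0)
    (hlt : l k₀ * d < 1) : Real.logb 2 d < -∑ k, l k * Real.logb 2 (l k) := by
  have hlog : ∀ k, 0 < l k → Real.logb 2 (l k) + Real.logb 2 d = Real.logb 2 (l k * d) :=
    fun k hk => (Real.logb_mul hk.ne' hd.ne').symm
  rw [← Finset.sum_neg_distrib, ← one_mul (Real.logb 2 d), ← hl1, Finset.sum_mul]
  refine Finset.sum_lt_sum (fun k _ => ?_) ⟨k₀, Finset.mem_univ _, ?_⟩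
  · rcases (hl k).eq_or_lt with hk | hk
    · simp [← hk]
    · have := Real.logb_nonpos one_lt_two (mul_pos hk hd).le (hle k)
      nlinarith [hlog k hk]
  · have hk := (hl k₀).lt_of_ne' hk₀
    have := Real.logb_neg one_lt_two (mul_pos hk hd) hlt
    nlinarith [hlog k₀ hk]

/-- if every masked state of a universal quantum masker for `d`-dimensional
states (`d ≥ 2`) is separable, then the entropy of the safe state is strictly larger
than `log₂ d`. -/
theorem separable_masker_entropy_strict_bound
    (d s dA dB : ℕ) (hd : 2 ≤ d) (hs : 0 < s) (hdA : 0 < dA) (hdB : 0 < dB)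
    (hdim : d * s = dA * dB)
    (M : Matrix (Fin dA × Fin dB) (Fin d × Fin s) ℂ)
    (ω : Matrix (Fin s) (Fin s) ℂ)
    (hM : IsMasker d s dA dB M ω)
    (hsep : ∀ ρ : Matrix (Fin d) (Fin d) ℂ, IsDensity ρ →
      ∃ (r : ℕ) (p : Fin r → ℝ)
        (α : Fin r → Matrix (Fin dA) (Fin dA) ℂ) (β : Fin r → Matrix (Fin dB) (Fin dB) ℂ),
        (∀ k, 0 ≤ p k) ∧ (∑ k, p k = 1) ∧
        (∀ k, IsDensity (α k)) ∧ (∀ k, IsDensity (β k)) ∧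
        M * (ρ ⊗ₖ ω) * Mᴴ = ∑ k, (p k : ℂ) • (α k ⊗ₖ β k)) :
    Real.logb 2 d < vNEntropy ω := by
  obtain ⟨hMM, hMM', hω, σA, σB, hσA, hσB, hmarg⟩ := hM
  have : Nontrivial (Fin d) := Fin.nontrivial_iff_two_le.2 hd
  obtain ⟨U, hU, hU', hUω, hl, hl1⟩ := hω.exists_diagonalization
  obtain ⟨V, hV, hV', hVσ, hμ, hμ1⟩ := hσA.exists_diagonalization
  obtain ⟨W, hW, hW', hWσ, hν, hν1⟩ := hσB.exists_diagonalization
  have hS : vNEntropy ω = -∑ i, hω.1.isHermitian.eigenvalues i *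
      Real.logb 2 (hω.1.isHermitian.eigenvalues i) := dif_pos hω.1.isHermitian
  rw [hS]
  generalize hω.1.isHermitian.eigenvalues = l at *
  generalize hσA.1.isHermitian.eigenvalues = μ at *
  generalize hσB.1.isHermitian.eigenvalues = ν at *
  have hω' : ω = U * diagonal (fun k => (l k : ℂ)) * Uᴴ := by
    rw [← hUω, ← Matrix.mul_assoc, ← Matrix.mul_assoc, hU', Matrix.one_mul, Matrix.mul_assoc,
      hU', Matrix.mul_one]
  obtain ⟨E, hE⟩ : ∃ E, E = (1 : Matrix (Fin d) (Fin d) ℂ) ⊗ₖ U := ⟨_, rfl⟩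
  obtain ⟨F, hF⟩ : ∃ F, F = Vᴴ ⊗ₖ Wᴴ := ⟨_, rfl⟩
  have hEE : Eᴴ * E = 1 := by
    simp [hE, conjTranspose_kronecker, ← mul_kronecker_mul, hU]
  have hEE' : E * Eᴴ = 1 := by
    simp [hE, conjTranspose_kronecker, ← mul_kronecker_mul, hU']
  have hFF : Fᴴ * F = 1 := by
    simp [hF, conjTranspose_kronecker, ← mul_kronecker_mul, hV', hW']
  have hFF' : F * Fᴴ = 1 := by
    simp [hF, conjTranspose_kronecker, ← mul_kronecker_mul, hV, hW]
  obtain ⟨N, hN⟩ : ∃ N, N = F * M * E := ⟨_, rfl⟩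
  have hNN : Nᴴ * N = 1 := by
    calc Nᴴ * N = Eᴴ * (Mᴴ * (Fᴴ * F) * M) * E := by
          simp only [hN, conjTranspose_mul, Matrix.mul_assoc]
      _ = 1 := by rw [hFF, Matrix.mul_one, hMM, Matrix.mul_one, hEE]
  have hNN' : N * Nᴴ = 1 := by
    calc N * Nᴴ = F * (M * (E * Eᴴ) * Mᴴ) * Fᴴ := by
          simp only [hN, conjTranspose_mul, Matrix.mul_assoc]
      _ = 1 := by rw [hEE', Matrix.mul_one, hMM', Matrix.mul_one, hFF']
  have hconj : ∀ ρ : Matrix (Fin d) (Fin d) ℂ,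
      N * (ρ ⊗ₖ diagonal fun k => (l k : ℂ)) * Nᴴ = F * (M * (ρ ⊗ₖ ω) * Mᴴ) * Fᴴ := by
    intro ρ
    have h1 : ρ ⊗ₖ ω = E * (ρ ⊗ₖ diagonal fun k => (l k : ℂ)) * Eᴴ := by
      rw [hE, conjTranspose_kronecker, ← mul_kronecker_mul, ← mul_kronecker_mul, ← hω',
        conjTranspose_one, Matrix.one_mul, Matrix.mul_one]
    rw [h1, hN]
    simp only [conjTranspose_mul, Matrix.mul_assoc]
  have hmask : MaskTensor (fun i k m n => N (m, n) (i, k)) l μ ν := by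
    refine maskTensor_of_ptrace hNN hNN' hl hμ hν hμ1 hν1 (fun ρ hρ => ?_) fun ρ hρ => ?_
    · rw [hconj, hF, ptrace2_conj_kronecker_s1 (by rwa [conjTranspose_conjTranspose]), (hmarg ρ hρ).1,
        conjTranspose_conjTranspose, hVσ]
    · rw [hconj, hF, ptrace1_conj_kronecker_s1 (by rwa [conjTranspose_conjTranspose]), (hmarg ρ hρ).2,
        conjTranspose_conjTranspose, hWσ]
  have hsep' : SeparableOutputs (fun i k m n => N (m, n) (i, k)) l := by
    refine separableOutputs_of_decomposition hNN hNN' fun ρ hρ => ?_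
    obtain ⟨r, p, α, β, hp, -, hα, hβ, hΦ⟩ := hsep ρ hρ
    refine ⟨r, p, fun k => Vᴴ * α k * V, fun k => Wᴴ * β k * W, hp,
      fun k => (hα k).1.conjTranspose_mul_mul_same V,
      fun k => (hβ k).1.conjTranspose_mul_mul_same W, ?_⟩
    rw [hconj, hF, hΦ, Matrix.mul_sum, Matrix.sum_mul]
    refine Finset.sum_congr rfl fun k _ => ?_
    rw [Matrix.mul_smul, Matrix.smul_mul, conjTranspose_kronecker, ← mul_kronecker_mul,
      ← mul_kronecker_mul, conjTranspose_conjTranspose, conjTranspose_conjTranspose]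
  have hle : ∀ k, l k * d ≤ 1 := fun k => by simpa using hmask.eigenvalue_le k
  by_contra hlt
  refine hmask.not_separableOutputs (fun k hk => ?_) hsep'
  rw [Fintype.card_fin]
  by_contra hne
  exact hlt (logb_lt_entropy (by positivity) hl hl1 hle hk ((hle k).lt_of_ne hne))

end
end

section
/- Let d ≥ 2 and let (M, ω) be a universal quantum masker for d-dimensional states, with M a unitary from ℂ^d⊗ℂ^s to ℂ^{d_A}⊗ℂ^{d_B} and safe state ω on ℂ^s. Suppose in addition that every masked state is quantum-classical: there exists an orthonormal basis {e_j} of ℂ^{d_B}, independent of the input, such that for every density matrix ρ on ℂ^d the state Φ(ρ) = M(ρ⊗ω)M† satisfies Φ(ρ) = ∑_j (I⊗|e_j⟩⟨e_j|) Φ(ρ) (I⊗|e_j⟩⟨e_j|). Then the von Neumann entropy of ω is at least 2·log₂ d. -/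
open Matrix Kronecker
open scoped ComplexOrder

noncomputable section

lemma linearMap_eq_zero_of_density {n V : Type*} [Fintype n] [DecidableEq n] [AddCommGroup V]
    [Module ℂ V] (T : Matrix n n ℂ →ₗ[ℂ] V) (hT : ∀ ρ, IsDensity ρ → T ρ = 0) : T = 0 := by
  have hpsd : ∀ ρ : Matrix n n ℂ, ρ.PosSemidef → T ρ = 0 := by
    intro ρ hρ
    by_cases h0 : ρ.trace = 0
    · rw [hρ.trace_eq_zero_iff.mp h0, map_zero]
    · have := hT (ρ.trace⁻¹ • ρ) ⟨hρ.smul (inv_nonneg.mpr hρ.trace_nonneg), by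
        simp [Matrix.trace_smul, h0]⟩
      simpa [h0] using this
  have hv : ∀ v : n → ℂ, T (vecMulVec v (star v)) = 0 := fun v =>
    hpsd _ (posSemidef_vecMulVec_self_star v)
  have hpol : ∀ x y : n → ℂ, T (vecMulVec x (star y)) = 0 := by
    intro x y
    have h1 := hv (x + y)
    have h2 := hv (x + Complex.I • y)
    simp only [vecMulVec_add, add_vecMulVec, star_add, star_smul, vecMulVec_smul, smul_vecMulVec,
      map_add, map_smul, hv, zero_add, add_zero, smul_zero] at h1 h2
    have h3 : T (vecMulVec y (star x)) = - T (vecMulVec x (star y)) := by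
      exact eq_neg_of_add_eq_zero_left h1
    rw [h3] at h2
    have h4 : (-2 * Complex.I) • T (vecMulVec x (star y)) = 0 := by
      rw [← h2]; simp only [Complex.star_def, Complex.conj_I]; module
    simpa using h4
  refine LinearMap.ext fun X => ?_
  rw [matrix_eq_sum_single X]
  simp only [map_sum, LinearMap.zero_apply]
  refine Finset.sum_congr rfl fun i _ => Finset.sum_congr rfl fun j _ => ?_
  have hsingle : Matrix.single i j (X i j) =
      vecMulVec (Pi.single i (X i j)) (star (Pi.single j 1)) := by
    ext a b
    simp [vecMulVec_apply, Matrix.single_apply, Pi.single_apply]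
    grind
  rw [hsingle, hpol]

lemma commute_of_eq_sum {ι R : Type*} [Fintype ι] [DecidableEq ι] [Ring R] (P : ι → R) (x : R)
    (hP : ∀ i j, P i * P j = if i = j then P i else 0) (hx : x = ∑ j, P j * x * P j) (k : ι) :
    P k * x = x * P k := by
  have h1 : P k * x = P k * x * P k := by
    conv_lhs => rw [hx]
    simp [Finset.mul_sum, ← mul_assoc, hP]
  have h2 : x * P k = P k * x * P k := by
    conv_lhs => rw [hx]
    simp [Finset.sum_mul, mul_assoc, hP]
  rw [h1, h2]

lemma trace_compress_le {m n : Type*} [Fintype m] [Fintype n] [DecidableEq m] [DecidableEq n]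
    (σ : Matrix m m ℂ) (hσ : σ.PosSemidef) (W : Matrix m n ℂ) (c : ℝ) (hc : 0 < c)
    (hW : Wᴴ * W = (c : ℂ) • 1) : (Wᴴ * σ * W).trace ≤ c * σ.trace := by
  set H : Matrix m m ℂ := (c : ℂ) • 1 - W * Wᴴ with hH
  have hHH : Hᴴ = H := by simp [hH]
  have hsq : H * Hᴴ = (c : ℂ) • H := by
    rw [hHH]
    have : W * Wᴴ * (W * Wᴴ) = (c : ℂ) • (W * Wᴴ) := by
      rw [Matrix.mul_assoc, ← Matrix.mul_assoc Wᴴ, hW]; simp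
    simp only [hH, sub_mul, mul_sub, this]
    simp [smul_sub]
  have h0 : 0 ≤ (Hᴴ * σ * H).trace := (hσ.conjTranspose_mul_mul_same H).trace_nonneg
  have h1 : (Hᴴ * σ * H).trace = c * (c * σ.trace - (Wᴴ * σ * W).trace) := by
    rw [Matrix.mul_assoc, Matrix.trace_mul_comm, Matrix.mul_assoc, hsq, Matrix.mul_smul,
      Matrix.trace_smul, hH, Matrix.mul_sub, Matrix.trace_sub, Matrix.mul_assoc Wᴴ,
      Matrix.trace_mul_comm Wᴴ, Matrix.mul_assoc]
    simp
  rw [h1] at h0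
  have hc' : (0 : ℂ) < c := by exact_mod_cast hc
  exact sub_nonneg.mp (le_of_mul_le_mul_left (by simpa using h0) hc')

lemma sum_outer {n : Type*} [Fintype n] [DecidableEq n] (e : n → n → ℂ)
    (he : ∀ i j, star (e i) ⬝ᵥ e j = if i = j then 1 else 0) (k l : n) :
    ∑ i, e i k * star (e i l) = if k = l then 1 else 0 := by
  set E : Matrix n n ℂ := Matrix.of fun k i => e i k
  have h : Eᴴ * E = 1 := by
    ext i j
    simpa [Matrix.mul_apply, Matrix.one_apply, dotProduct, E] using he i j
  have h1 : E * Eᴴ = 1 := mul_eq_one_comm.mp h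
  have h' := congrFun (congrFun h1 k) l
  simpa [Matrix.mul_apply, Matrix.one_apply, E] using h'

lemma two_mul_logb_le_vNEntropy {n : Type*} [Fintype n] [DecidableEq n] (ω : Matrix n n ℂ)
    (hω : IsDensity ω) (d : ℕ) (hd : 0 < d)
    (h : ∀ (l : ℝ) (u : n → ℂ), 0 < l → u ≠ 0 → ω *ᵥ u = (l : ℂ) • u → (d : ℝ) ^ 2 * l ≤ 1) :
    2 * Real.logb 2 d ≤ vNEntropy ω := by
  have hH := hω.1.isHermitian
  rw [vNEntropy, dif_pos hH]
  have hsum : ∑ i, hH.eigenvalues i = 1 := by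
    have := hH.trace_eq_sum_eigenvalues
    rw [hω.2] at this
    simp only [Complex.coe_algebraMap] at this
    exact_mod_cast this.symm
  rw [← mul_one (2 * Real.logb 2 d), ← hsum, Finset.mul_sum, ← Finset.sum_neg_distrib]
  refine Finset.sum_le_sum fun i _ => ?_
  rcases (hω.1.eigenvalues_nonneg i).eq_or_lt with h0 | h0
  · simp [← h0]
  · have hle := h (hH.eigenvalues i) (hH.eigenvectorBasis i) h0
      (fun hz => hH.eigenvectorBasis.orthonormal.ne_zero i (by ext t; simpa using congrFun hz t))
      (by rw [hH.mulVec_eigenvectorBasis]; ext; simp)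
    have hd' : (0 : ℝ) < d := by exact_mod_cast hd
    have hlog : Real.logb 2 ((d : ℝ) ^ 2 * hH.eigenvalues i) ≤ 0 :=
      Real.logb_nonpos (by norm_num) (by positivity) hle
    rw [Real.logb_mul (by positivity) h0.ne', Real.logb_pow] at hlog
    push_cast at hlog
    nlinarith

/-- The vector `|a⟩ ⊗ u`. -/
def basisTensor {m n : Type*} [DecidableEq m] (a : m) (u : n → ℂ) : m × n → ℂ :=
  fun p => if p.1 = a then u p.2 else 0

lemma exists_mulVec_basisTensor {m n : Type*} [Fintype m] [Fintype n] [DecidableEq m]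
    [Nonempty m] (ω : Matrix n n ℂ) (G : Matrix (m × n) (m × n) ℂ)
    (hG : ∀ X : Matrix m m ℂ, G * (X ⊗ₖ ω) = (X ⊗ₖ ω) * G) (l : ℂ) (hl : l ≠ 0) (u : n → ℂ)
    (hu : ω *ᵥ u = l • u) :
    ∃ v, ω *ᵥ v = l • v ∧ ∀ a, G *ᵥ basisTensor a u = basisTensor a v := by
  let B : m → m → Matrix n n ℂ := fun p q => Matrix.of fun t t' => G (p, t) (q, t')
  have hrel : ∀ a b p, B p a * ω = if p = a then ω * B b b else 0 := by
    intro a b p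
    ext t t'
    have := congrFun (congrFun (hG (Matrix.single a b 1)) (p, t)) (b, t')
    simp only [Matrix.mul_apply, Fintype.sum_prod_type, kroneckerMap_apply, Matrix.single_apply]
      at this
    by_cases hp : p = a
    · simp [hp, Finset.sum_ite_irrel] at this
      simpa [hp, Matrix.mul_apply, B] using this
    · simp [Ne.symm hp, Finset.sum_ite_irrel] at this
      simpa [hp, Matrix.mul_apply, B] using this
  obtain ⟨b⟩ := ‹Nonempty m›
  have hB : ∀ p a, B p a *ᵥ u = if p = a then l⁻¹ • ((ω * B b b) *ᵥ u) else 0 := by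
    intro p a
    have h1 : (B p a * ω) *ᵥ u = l • (B p a *ᵥ u) := by
      rw [← mulVec_mulVec, hu, mulVec_smul]
    rw [hrel a b p] at h1
    rw [← inv_smul_smul₀ hl (B p a *ᵥ u), ← h1]
    split_ifs <;> simp
  refine ⟨l⁻¹ • ((ω * B b b) *ᵥ u), ?_, fun a => ?_⟩
  · have := hB b b
    rw [if_pos rfl] at this
    rw [← this, mulVec_mulVec, ← inv_smul_eq_iff₀ hl, ← this]
  · ext ⟨p, t⟩
    have := congrFun (hB p a) t
    have h2 : (G *ᵥ basisTensor a u) (p, t) = (B p a *ᵥ u) t := by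
      simp [mulVec, dotProduct, Fintype.sum_prod_type, basisTensor, B, Finset.sum_ite_irrel]
    rw [h2, this, basisTensor]
    split_ifs <;> rfl

lemma dotProduct_ptrace2_mulVec {m n : Type*} [Fintype m] [Fintype n] [DecidableEq n]
    (e : n → n → ℂ) (he : ∀ i j, star (e i) ⬝ᵥ e j = if i = j then 1 else 0)
    (R : Matrix (m × n) (m × n) ℂ) (x y : m → ℂ) :
    star x ⬝ᵥ (ptrace2 R *ᵥ y) =
      ∑ i, star (fun p : m × n => x p.1 * e i p.2) ⬝ᵥ (R *ᵥ fun p => y p.1 * e i p.2) := by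
  have hrhs : ∑ i, star (fun p : m × n => x p.1 * e i p.2) ⬝ᵥ (R *ᵥ fun p => y p.1 * e i p.2) =
      ∑ p : m × n, ∑ q : m × n, star (x p.1) * R p q * y q.1 *
        ∑ i, e i q.2 * star (e i p.2) := by
    simp only [dotProduct, mulVec, Pi.star_apply, Finset.mul_sum, star_mul']
    rw [Finset.sum_comm]
    refine Finset.sum_congr rfl fun p _ => ?_
    rw [Finset.sum_comm]
    refine Finset.sum_congr rfl fun q _ => Finset.sum_congr rfl fun i _ => ?_
    ring
  rw [hrhs]
  simp only [sum_outer e he, Fintype.sum_prod_type, mul_ite, mul_one, mul_zero,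
    Finset.sum_ite_eq', Finset.mem_univ, if_true, dotProduct, mulVec, ptrace2, Matrix.of_apply,
    Pi.star_apply, Finset.mul_sum, Finset.sum_mul]
  refine Finset.sum_congr rfl fun p _ => ?_
  rw [Finset.sum_comm]
  refine Finset.sum_congr rfl fun p _ => Finset.sum_congr rfl fun q _ => ?_
  ring

lemma dotProduct_conj_kronecker_single {m n k : Type*} [Fintype m] [Fintype n] [Fintype k]
    [DecidableEq m] (M : Matrix k (m × n) ℂ) (ω : Matrix n n ℂ) (a b : m) (x y : k → ℂ) :
    star x ⬝ᵥ ((M * (Matrix.single a b 1 ⊗ₖ ω) * Mᴴ) *ᵥ y) =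
      star (fun t => (Mᴴ *ᵥ x) (a, t)) ⬝ᵥ (ω *ᵥ fun t => (Mᴴ *ᵥ y) (b, t)) := by
  have h1 : star x ⬝ᵥ ((M * (Matrix.single a b 1 ⊗ₖ ω) * Mᴴ) *ᵥ y) =
      star (Mᴴ *ᵥ x) ⬝ᵥ ((Matrix.single a b 1 ⊗ₖ ω) *ᵥ (Mᴴ *ᵥ y)) := by
    rw [← mulVec_mulVec, ← mulVec_mulVec, star_mulVec, conjTranspose_conjTranspose,
      dotProduct_mulVec (star x) M]
  rw [h1]
  generalize Mᴴ *ᵥ x = f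
  generalize Mᴴ *ᵥ y = g
  simp only [dotProduct, mulVec, Fintype.sum_prod_type, kroneckerMap_apply, Matrix.single_apply,
    ite_and, ite_mul, one_mul, zero_mul, Finset.sum_ite_irrel, Finset.sum_const_zero,
    Pi.star_apply, mul_ite, mul_zero, Finset.sum_ite_eq, Finset.mem_univ, if_true]

lemma sq_card_mul_le_one {m n A B : Type*} [Fintype m] [Fintype n] [Fintype A] [Fintype B]
    [DecidableEq m] [DecidableEq n] [DecidableEq A] [DecidableEq B]
    (M : Matrix (A × B) (m × n) ℂ) (hM : Mᴴ * M = 1) (ω : Matrix n n ℂ) (hω : ω.PosSemidef)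
    (σ : Matrix A A ℂ) (hσ : IsDensity σ)
    (hTr : ∀ X : Matrix m m ℂ, ptrace2 (M * (X ⊗ₖ ω) * Mᴴ) = X.trace • σ)
    (e : B → B → ℂ) (he : ∀ i j, star (e i) ⬝ᵥ e j = if i = j then 1 else 0)
    (l : ℝ) (v : n → ℂ) (hv0 : v ≠ 0) (hv : ω *ᵥ v = (l : ℂ) • v) (j : B)
    (hj : ∀ a, ((1 : Matrix A A ℂ) ⊗ₖ outer (e j)) *ᵥ (M *ᵥ basisTensor a v) =
      M *ᵥ basisTensor a v) :
    (Fintype.card m : ℝ) ^ 2 * l ≤ 1 := by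
  obtain ⟨c, hc, hcv⟩ : ∃ c : ℝ, 0 < c ∧ star v ⬝ᵥ v = c := by
    have h := dotProduct_star_self_pos_iff.mpr hv0
    obtain ⟨h1, h2⟩ := Complex.lt_def.mp h
    exact ⟨(star v ⬝ᵥ v).re, h1, Complex.ext rfl h2.symm⟩
  let W : Matrix A m ℂ := Matrix.of fun p a =>
    ∑ k, (M *ᵥ basisTensor a v) (p, k) * star (e j k)
  have hMW : ∀ a, M *ᵥ basisTensor a v = fun p => W p.1 a * e j p.2 := by
    intro a
    rw [← hj a]
    ext ⟨p, k⟩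
    rw [mulVec, dotProduct, Fintype.sum_prod_type]
    simp only [kroneckerMap_apply, Matrix.one_apply, ite_mul, one_mul, zero_mul,
      Finset.sum_ite_irrel, Finset.sum_const_zero, Finset.sum_ite_eq, Finset.mem_univ, if_true,
      outer, Matrix.of_apply, W, Finset.sum_mul, starRingEnd_apply]
    exact Finset.sum_congr rfl fun _ _ => by ring
  have hWW : Wᴴ * W = (c : ℂ) • 1 := by
    ext a b
    have h1 : star (M *ᵥ basisTensor a v) ⬝ᵥ (M *ᵥ basisTensor b v) =
        star (basisTensor a v) ⬝ᵥ basisTensor b v := by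
      rw [star_mulVec, ← dotProduct_mulVec, mulVec_mulVec, hM, one_mulVec]
    have h2 : star (basisTensor a v) ⬝ᵥ basisTensor b v = if a = b then (c : ℂ) else 0 := by
      rw [← hcv]
      simp only [dotProduct, Fintype.sum_prod_type, basisTensor, Pi.star_apply, mul_ite, mul_zero,
        Finset.sum_ite_irrel, Finset.sum_const_zero, Finset.sum_ite_eq', Finset.mem_univ, if_true]
      by_cases hab : a = b
      · simp [hab]
      · simp [hab, Ne.symm hab]
    have h3 : star (M *ᵥ basisTensor a v) ⬝ᵥ (M *ᵥ basisTensor b v) =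
        (Wᴴ * W) a b * (star (e j) ⬝ᵥ e j) := by
      rw [hMW, hMW]
      simp only [dotProduct, Fintype.sum_prod_type, Matrix.mul_apply, Finset.sum_mul_sum,
        conjTranspose_apply, Pi.star_apply, star_mul']
      exact Finset.sum_congr rfl fun _ _ => Finset.sum_congr rfl fun _ _ => by ring
    rw [he, if_pos rfl, mul_one] at h3
    rw [← h3, h1, h2]
    simp [Matrix.one_apply]
  let η : B → m → m × n → ℂ := fun i a => Mᴴ *ᵥ fun p => W p.1 a * e i p.2
  let z : B → n → ℂ := fun i => ∑ a, fun t => η i a (a, t)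
  have hzj : z j = (Fintype.card m : ℂ) • v := by
    have h1 : ∀ a, η j a = basisTensor a v := by
      intro a
      simp only [η]
      rw [← hMW, mulVec_mulVec, hM, one_mulVec]
    ext t
    simp [z, h1, basisTensor]
  have hterm : ∀ a b, star (Wᵀ a) ⬝ᵥ
      (ptrace2 (M * (Matrix.single a b 1 ⊗ₖ ω) * Mᴴ) *ᵥ Wᵀ b) =
      ∑ i, star (fun t => η i a (a, t)) ⬝ᵥ (ω *ᵥ fun t => η i b (b, t)) := by
    intro a b
    rw [dotProduct_ptrace2_mulVec e he]
    exact Finset.sum_congr rfl fun i _ => dotProduct_conj_kronecker_single ..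
  have hsum : (Wᴴ * σ * W).trace = ∑ i, star (z i) ⬝ᵥ (ω *ᵥ z i) := by
    have h1 : ∑ a, ∑ b, star (Wᵀ a) ⬝ᵥ
        (ptrace2 (M * (Matrix.single a b 1 ⊗ₖ ω) * Mᴴ) *ᵥ Wᵀ b) = (Wᴴ * σ * W).trace := by
      have h2 : ∀ a b : m, (Matrix.single a b (1 : ℂ)).trace = if a = b then 1 else 0 := by
        intro a b
        split_ifs with h
        · simp [h]
        · simp [Matrix.trace_single_eq_of_ne _ _ _ h]
      simp only [hTr, h2, ite_smul, one_smul, zero_smul]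
      rw [Matrix.trace]
      refine Finset.sum_congr rfl fun a _ => ?_
      rw [Finset.sum_eq_single a (fun b _ hb => by simp [Ne.symm hb]) (by simp), if_pos rfl,
        Matrix.mul_assoc]
      rfl
    rw [← h1]
    simp only [hterm, z, star_sum, sum_dotProduct, mulVec_sum, dotProduct_sum]
    simp only [Finset.sum_comm (s := (Finset.univ : Finset m)) (t := (Finset.univ : Finset B))]
    exact Finset.sum_congr rfl fun _ _ => Finset.sum_comm
  have hle : star (z j) ⬝ᵥ (ω *ᵥ z j) ≤ c * σ.trace := by
    refine le_trans ?_ (trace_compress_le σ hσ.1 W c hc hWW)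
    rw [hsum]
    exact Finset.single_le_sum (f := fun i => star (z i) ⬝ᵥ (ω *ᵥ z i))
      (fun i _ => hω.dotProduct_mulVec_nonneg _) (Finset.mem_univ j)
  rw [hzj, hσ.2, mul_one, mulVec_smul, hv, star_smul, smul_dotProduct, dotProduct_smul,
    dotProduct_smul, hcv] at hle
  simp only [smul_eq_mul, star_natCast] at hle
  have hle' : (Fintype.card m : ℝ) * (Fintype.card m * (l * c)) ≤ c := by exact_mod_cast hle
  refine le_of_mul_le_mul_right ?_ hc
  linarith

/-- if every masked state of a universal quantum masker for `d`-dimensional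
states (`d ≥ 2`) is quantum-classical with respect to a fixed orthonormal basis `{e j}`
of `ℂ^{dB}`, then the entropy of the safe state is at least `2 log₂ d`. -/
theorem qc_masker_entropy_bound
    (d s dA dB : ℕ) (hd : 2 ≤ d) (hs : 0 < s) (hdA : 0 < dA) (hdB : 0 < dB)
    (hdim : d * s = dA * dB)
    (M : Matrix (Fin dA × Fin dB) (Fin d × Fin s) ℂ)
    (ω : Matrix (Fin s) (Fin s) ℂ)
    (hM : IsMasker d s dA dB M ω)
    (e : Fin dB → (Fin dB → ℂ))
    (he : ∀ i j, star (e i) ⬝ᵥ e j = if i = j then 1 else 0)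
    (hespan : Submodule.span ℂ (Set.range e) = ⊤)
    (hqc : ∀ ρ : Matrix (Fin d) (Fin d) ℂ, IsDensity ρ →
      M * (ρ ⊗ₖ ω) * Mᴴ =
        ∑ j, ((1 : Matrix (Fin dA) (Fin dA) ℂ) ⊗ₖ outer (e j)) * (M * (ρ ⊗ₖ ω) * Mᴴ) *
          ((1 : Matrix (Fin dA) (Fin dA) ℂ) ⊗ₖ outer (e j))) :
    2 * Real.logb 2 d ≤ vNEntropy ω := by
  obtain ⟨hM1, hM2, hω, σ, _, hσ, -, hmask⟩ := hM
  have : NeZero d := ⟨by omega⟩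
  let P : Fin dB → Matrix (Fin dA × Fin dB) (Fin dA × Fin dB) ℂ :=
    fun j => (1 : Matrix (Fin dA) (Fin dA) ℂ) ⊗ₖ outer (e j)
  have hP : ∀ i j, P i * P j = if i = j then P i else 0 := by
    intro i j
    have h : outer (e i) * outer (e j) = if i = j then outer (e i) else 0 := by
      have : outer (e i) * outer (e j) = (star (e i) ⬝ᵥ e j) • vecMulVec (e i) (star (e j)) :=
        (vecMulVec_mul_vecMulVec ..).trans (vecMulVec_smul ..)
      rw [this, he]
      split_ifs with hij
      · subst hij; simp; rfl
      · simp
    simp only [P, ← mul_kronecker_mul, h, mul_one]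
    split_ifs <;> simp
  have hPsum : ∑ j, P j = 1 := by
    ext ⟨p, k⟩ ⟨q, l⟩
    have := sum_outer e he k l
    simp only [Matrix.sum_apply, P, kroneckerMap_apply, outer, Matrix.of_apply,
      starRingEnd_apply, ← Finset.mul_sum, this, Matrix.one_apply, Prod.mk.injEq]
    by_cases h1 : p = q <;> by_cases h2 : k = l <;> simp [h1, h2]
  have hTr : ∀ X : Matrix (Fin d) (Fin d) ℂ, ptrace2 (M * (X ⊗ₖ ω) * Mᴴ) = X.trace • σ := by
    let T : Matrix (Fin d) (Fin d) ℂ →ₗ[ℂ] Matrix (Fin dA) (Fin dA) ℂ :=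
      { toFun := fun X => ptrace2 (M * (X ⊗ₖ ω) * Mᴴ) - X.trace • σ
        map_add' := fun X Y => by
          ext
          simp [ptrace2, add_kronecker, Matrix.mul_add, Matrix.add_mul, Finset.sum_add_distrib,
            add_mul]
          ring
        map_smul' := fun c X => by
          ext
          simp [ptrace2, smul_kronecker, Finset.mul_sum, mul_sub, mul_assoc] }
    have hT := linearMap_eq_zero_of_density T fun ρ hρ => by
      simp [T, (hmask ρ hρ).1, hρ.2]
    exact fun X => sub_eq_zero.mp (LinearMap.congr_fun hT X)
  have hcomm : ∀ j, ∀ X : Matrix (Fin d) (Fin d) ℂ,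
      P j * (M * (X ⊗ₖ ω) * Mᴴ) = (M * (X ⊗ₖ ω) * Mᴴ) * P j := by
    intro j
    let T : Matrix (Fin d) (Fin d) ℂ →ₗ[ℂ] Matrix (Fin dA × Fin dB) (Fin dA × Fin dB) ℂ :=
      { toFun := fun X => P j * (M * (X ⊗ₖ ω) * Mᴴ) - (M * (X ⊗ₖ ω) * Mᴴ) * P j
        map_add' := fun X Y => by
          simp only [add_kronecker, Matrix.mul_add, Matrix.add_mul]
          abel
        map_smul' := fun c X => by
          simp [smul_kronecker, smul_sub] }
    have hT := linearMap_eq_zero_of_density T fun ρ hρ =>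
      sub_eq_zero.mpr (commute_of_eq_sum P _ hP (hqc ρ hρ) j)
    exact fun X => sub_eq_zero.mp (LinearMap.congr_fun hT X)
  have hG : ∀ j, ∀ X : Matrix (Fin d) (Fin d) ℂ,
      (Mᴴ * P j * M) * (X ⊗ₖ ω) = (X ⊗ₖ ω) * (Mᴴ * P j * M) := by
    intro j X
    have h := congrArg (fun Y => Mᴴ * Y * M) (hcomm j X)
    have h1 : Mᴴ * (P j * (M * (X ⊗ₖ ω) * Mᴴ)) * M =
        (Mᴴ * P j * M) * (X ⊗ₖ ω) * (Mᴴ * M) := by simp only [Matrix.mul_assoc]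
    have h2 : Mᴴ * ((M * (X ⊗ₖ ω) * Mᴴ) * P j) * M =
        (Mᴴ * M) * ((X ⊗ₖ ω) * (Mᴴ * P j * M)) := by simp only [Matrix.mul_assoc]
    simp only [h1, h2, hM1, mul_one, one_mul] at h
    exact h
  refine two_mul_logb_le_vNEntropy ω hω d (by omega) fun l u hl hu0 hu => ?_
  have hl' : (l : ℂ) ≠ 0 := by exact_mod_cast hl.ne'
  choose v hv hGv using fun j =>
    exists_mulVec_basisTensor ω (Mᴴ * P j * M) (hG j) (l : ℂ) hl' u hu
  have hvj : ∃ j, v j ≠ 0 := by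
    by_contra! h
    refine hu0 (funext fun t => ?_)
    have h1 : ∑ j, (Mᴴ * P j * M) *ᵥ basisTensor (0 : Fin d) u = basisTensor 0 u := by
      rw [← sum_mulVec, ← Matrix.sum_mul, ← Matrix.mul_sum, hPsum, Matrix.mul_one, hM1, one_mulVec]
    simp only [hGv, h] at h1
    simpa [basisTensor] using (congrFun h1 (0, t)).symm
  obtain ⟨j, hj⟩ := hvj
  have hPv : ∀ a, P j *ᵥ (M *ᵥ basisTensor a (v j)) = M *ᵥ basisTensor a (v j) := by
    intro a
    have h1 : M *ᵥ basisTensor a (v j) = P j *ᵥ (M *ᵥ basisTensor a u) := by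
      rw [← hGv j a, mulVec_mulVec, mulVec_mulVec, Matrix.mul_assoc, ← Matrix.mul_assoc M, hM2,
        Matrix.one_mul]
    rw [h1, mulVec_mulVec, hP, if_pos rfl]
  simpa using sq_card_mul_le_one M hM1 ω hω.1 σ hσ hTr e he l (v j) hj (hv j) j hPv

end
end
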